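/- arXiv:2202.02638 — 5 statements merged into one kernel-verified Lean document; each statement's English description precedes it below -/
import Mathlib

section
/- For every balayage π and every μ ∈ P_MC^π(𝒮): μ has trivial tail if and only if Φ(μ) is an extreme point of 𝒟(π). -/
open MeasureTheory Filter
open scoped ENNReal NNReal

namespace VMCPaper

abbrev Path : Type := ℕ → ℕ

def staircaseSet : Set Path :=
  {S | (∀ N, S N ≤ N) ∧ ∀ N, S (N + 1) = S N ∨ S (N + 1) = N + 1}

noncomputable def pr {α : Type*} [MeasurableSpace α] (μ : Measure α) (A : Set α) : ℝ :=
  (μ A).toReal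

def IsSMC (μ : Measure Path) : Prop :=
  IsProbabilityMeasure μ ∧ μ staircaseSet = 1 ∧
  ∀ (N : ℕ) (a : ℕ → ℕ),
    0 < pr μ {S | ∀ i ≤ N, S i = a i} →
    pr μ {S | (∀ i ≤ N, S i = a i) ∧ S (N + 1) = a (N + 1)} /
        pr μ {S | ∀ i ≤ N, S i = a i}
      = pr μ {S | S N = a N ∧ S (N + 1) = a (N + 1)} / pr μ {S | S N = a N}

noncomputable def marginals (μ : Measure Path) : ℕ → ℕ → ℝ :=
  fun N a => pr μ {S | S N = a}

def D : Set (ℕ → ℕ → ℝ) :=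
  {ν | (∀ N a, 0 ≤ ν N a) ∧ (∀ N a, N < a → ν N a = 0) ∧
       (∀ N, ∑ a ∈ Finset.range (N + 1), ν N a = 1) ∧
       ∀ N a, a ≤ N → ν (N + 1) a ≤ ν N a}

def PMC : Set (ProbabilityMeasure Path) := {μ | IsSMC (μ : Measure Path)}

def IsBalayage (π : ℕ → ℕ → ℝ) : Prop :=
  (∀ N a, 0 ≤ π N a) ∧ (∀ N a, N < a → π N a = 0) ∧
  ∀ N, ∑ a ∈ Finset.range (N + 1), π N a = 1

def Dpi (π : ℕ → ℕ → ℝ) : Set (ℕ → ℕ → ℝ) :=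
  {ν | ν ∈ D ∧ ∀ N a, a ≤ N → ν N a = ν (N + 1) a + ν (N + 1) (N + 1) * π N a}

def PMCpi (π : ℕ → ℕ → ℝ) : Set (Measure Path) :=
  {μ | IsSMC μ ∧ ∀ N a, a ≤ N →
    0 < pr μ {S | S (N + 1) = N + 1} →
    pr μ {S | S N = a ∧ S (N + 1) = N + 1} / pr μ {S | S (N + 1) = N + 1} = π N a}

def pathTail : MeasurableSpace Path :=
  ⨅ N : ℕ, MeasurableSpace.comap (fun (S : Path) (i : ℕ) => S (N + i)) inferInstance

def HasTrivialTail (μ : Measure Path) : Prop :=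
  ∀ A : Set Path, MeasurableSet[pathTail] A → μ A = 0 ∨ μ A = 1

def AffineOn {E : Type*} [AddCommMonoid E] [Module ℝ E] (f : E → ℝ) (K : Set E) : Prop :=
  ∀ x ∈ K, ∀ y ∈ K, ∀ t : ℝ, 0 ≤ t → t ≤ 1 →
    f (t • x + (1 - t) • y) = t * f x + (1 - t) * f y

def RepresentsOn {E : Type*} [AddCommMonoid E] [Module ℝ E] [TopologicalSpace E]
    [MeasurableSpace E] (m : Measure E) (K : Set E) (x : E) : Prop :=
  ∀ f : E → ℝ, ContinuousOn f K → AffineOn f K → f x = ∫ y, f y ∂m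

def IsChoquetSimplex {E : Type*} [AddCommMonoid E] [Module ℝ E] [TopologicalSpace E]
    [MeasurableSpace E] (K : Set E) : Prop :=
  ∀ x ∈ K, ∃! m : Measure E,
    IsProbabilityMeasure m ∧ m (Set.extremePoints ℝ K) = 1 ∧ RepresentsOn m K x

noncomputable def hitTime (x : Path) (A : Set ℕ) : ℕ → ℕ∞
  | 0 => ⨅ i ∈ {i : ℕ | x i ∈ A}, (i : ℕ∞)
  | k + 1 => ⨅ i ∈ {i : ℕ | hitTime x A k < (i : ℕ∞) ∧ x i ∈ A}, (i : ℕ∞)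

noncomputable def proj (N : ℕ) (x : Path) : Path := fun i =>
  if hitTime x {a | a ≤ N} i = ⊤ then 0 else x (hitTime x {a | a ≤ N} i).toNat

def pathSpace (N : ℕ) : Set Path :=
  {x | (∀ i, x i ≤ N) ∧ ∀ i, x i = 0 → ∀ j, i ≤ j → x j = 0}

def fullPathSpace : Set Path := {x | ∀ i, x i = 0 → ∀ j, i ≤ j → x j = 0}

def IsMarkovChain {Ω : Type*} [MeasurableSpace Ω] (P : Measure Ω) (Y : ℕ → Ω → ℕ) : Prop :=
  (∀ i, Measurable (Y i)) ∧
  (∀ (n : ℕ) (b : ℕ → ℕ),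
    0 < (P {ω | ∀ i ≤ n, Y i ω = b i}).toReal →
    (P {ω | (∀ i ≤ n, Y i ω = b i) ∧ Y (n + 1) ω = b (n + 1)}).toReal /
        (P {ω | ∀ i ≤ n, Y i ω = b i}).toReal
      = (P {ω | Y n ω = b n ∧ Y (n + 1) ω = b (n + 1)}).toReal /
        (P {ω | Y n ω = b n}).toReal) ∧
  (∀ m n b c : ℕ,
    0 < (P {ω | Y m ω = b}).toReal → 0 < (P {ω | Y n ω = b}).toReal →
    (P {ω | Y m ω = b ∧ Y (m + 1) ω = c}).toReal / (P {ω | Y m ω = b}).toReal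
      = (P {ω | Y n ω = b ∧ Y (n + 1) ω = c}).toReal / (P {ω | Y n ω = b}).toReal)

def IsVMC {Ω : Type*} [MeasurableSpace Ω] (P : Measure Ω) (X : Ω → ℕ → Path) : Prop :=
  IsProbabilityMeasure P ∧
  Measurable X ∧
  (∀ ω N, X ω N ∈ pathSpace N) ∧
  (∀ ω N, proj N (X ω (N + 1)) = X ω N) ∧
  ∀ N, IsMarkovChain P (fun i ω => X ω N i)

def S0 {Ω : Type*} (X : Ω → ℕ → Path) (N : ℕ) (ω : Ω) : ℕ := X ω N 0

noncomputable def Vis {Ω : Type*} (X : Ω → ℕ → Path) (a : ℕ) (ω : Ω) : ℕ∞ :=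
  {k : ℕ | hitTime (X ω a) {a} k ≠ ⊤}.encard

open scoped Classical in
noncomputable def Sak {Ω : Type*} (X : Ω → ℕ → Path) (a k N : ℕ) (ω : Ω) : ℕ :=
  if (k : ℕ∞) < Vis X a ω ∧ hitTime (X ω N) {a} k ≠ ⊤ then
    X ω N ((hitTime (X ω N) {a} k).toNat + 1)
  else 0

def InfinitelyVisited {Ω : Type*} [MeasurableSpace Ω] (P : Measure Ω)
    (X : Ω → ℕ → Path) (a : ℕ) : Prop := P {ω | Vis X a ω = ⊤} = 1

def OnceVisited {Ω : Type*} [MeasurableSpace Ω] (P : Measure Ω)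
    (X : Ω → ℕ → Path) (a : ℕ) : Prop := P {ω | Vis X a ω = 1} = 1

def NeverVisited {Ω : Type*} [MeasurableSpace Ω] (P : Measure Ω)
    (X : Ω → ℕ → Path) (a : ℕ) : Prop := P {ω | Vis X a ω = 0} = 1

def RandomlyVisited {Ω : Type*} [MeasurableSpace Ω] (P : Measure Ω)
    (X : Ω → ℕ → Path) (a : ℕ) : Prop :=
  ¬ InfinitelyVisited P X a ∧ ¬ OnceVisited P X a ∧ ¬ NeverVisited P X a

def sigmaX {Ω : Type*} (X : Ω → ℕ → Path) : MeasurableSpace Ω :=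
  MeasurableSpace.comap X inferInstance

def tailVMC {Ω : Type*} (X : Ω → ℕ → Path) : MeasurableSpace Ω :=
  ⨅ N : ℕ, MeasurableSpace.comap (fun ω (M : ℕ) => X ω (N + M)) inferInstance

def TailTrivial {Ω : Type*} [MeasurableSpace Ω] (P : Measure Ω) (X : Ω → ℕ → Path) : Prop :=
  ∀ A : Set Ω, MeasurableSet[tailVMC X] A → P A = 0 ∨ P A = 1

def RepresentedBy {Ω : Type*} [MeasurableSpace Ω] (P : Measure Ω) (X : Ω → ℕ → Path)
    (ν : ℕ → ℕ → ℝ) (K : ℕ → ℕ → ℕ → ℝ) : Prop :=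
  (∀ N a, a ≤ N → (P {ω | X ω N 0 = a}).toReal = ν N a) ∧
  ∀ N a b, a ≤ N → b ≤ N → 0 < (P {ω | X ω N 0 = a}).toReal →
    (P {ω | X ω N 0 = a ∧ X ω N 1 = b}).toReal / (P {ω | X ω N 0 = a}).toReal = K N a b

noncomputable def piK (K : ℕ → ℕ → ℕ → ℝ) (N : ℕ) (b : ℕ) : ℝ :=
  if K (N + 1) (N + 1) (N + 1) < 1 then
    K (N + 1) (N + 1) b / (1 - K (N + 1) (N + 1) (N + 1))
  else if b = 0 then 1 else 0

def IsVTM (K : ℕ → ℕ → ℕ → ℝ) : Prop :=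
  (∀ N a b, 0 ≤ K N a b) ∧
  (∀ N a b, a ≤ N → N < b → K N a b = 0) ∧
  (∀ N a, a ≤ N → ∑ b ∈ Finset.range (N + 1), K N a b = 1) ∧
  (∀ N, K N 0 0 = 1) ∧
  (∀ N a b, a ≤ N → b ≤ N → K N a b = K (N + 1) a b + K (N + 1) a (N + 1) * piK K N b)

def mpow (N : ℕ) (M : ℕ → ℕ → ℝ) : ℕ → ℕ → ℕ → ℝ
  | 0 => fun a b => if a = b then 1 else 0
  | n + 1 => fun a b => ∑ c ∈ Finset.range (N + 1), mpow N M n a c * M c b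

def IsIrreducibleVTM (K : ℕ → ℕ → ℕ → ℝ) : Prop :=
  ∀ N, 1 ≤ N → ∀ a b, 1 ≤ a → a ≤ N → 1 ≤ b → b ≤ N →
    ∃ n, 0 < mpow N (K N) n a b

def IsClassical {Ω : Type*} [MeasurableSpace Ω] (P : Measure Ω) (X : Ω → ℕ → Path) : Prop :=
  ∀ᵐ ω ∂P, ∃ x : Path, x ∈ fullPathSpace ∧
    (∀ i, ∀ᶠ N in atTop, X ω N i = x i) ∧ ∀ N, X ω N = proj N x


open Preorder

theorem aux_meas_coord (i c : ℕ) : MeasurableSet {S : Path | S i = c} :=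
  measurableSet_eq_fun (measurable_pi_apply i) measurable_const

theorem aux_map_eq (m1 m2 : Measure Path) (N : ℕ)
    (h : ∀ a : Path, m1 {S | ∀ i ≤ N, S i = a i} = m2 {S | ∀ i ≤ N, S i = a i}) :
    m1.map (frestrictLe (π := fun _ => ℕ) N) = m2.map (frestrictLe (π := fun _ => ℕ) N) := by
  apply Measure.ext_of_singleton
  intro t
  have hm : Measurable (frestrictLe (π := fun _ : ℕ => ℕ) N) := measurable_frestrictLe N
  rw [Measure.map_apply hm (MeasurableSet.singleton t),
    Measure.map_apply hm (MeasurableSet.singleton t)]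
  have e : (frestrictLe (π := fun _ : ℕ => ℕ) N) ⁻¹' {t} =
      {S : Path | ∀ i ≤ N, S i = (fun j => if hj : j ≤ N then t ⟨j, Finset.mem_Iic.2 hj⟩ else 0) i} := by
    ext S
    simp only [Set.mem_preimage, Set.mem_singleton_iff, Set.mem_ofPred_eq]
    constructor
    · rintro rfl i hi
      simp [hi]
    · intro hS
      funext ⟨i, hi⟩
      have := hS i (Finset.mem_Iic.1 hi)
      simp only [Finset.mem_Iic.1 hi, dite_true] at this
      exact this
  rw [e]
  exact h _

theorem aux_ext_path (m1 m2 : Measure Path) [IsFiniteMeasure m1] [IsFiniteMeasure m2]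
    (h : ∀ (N : ℕ) (a : Path), m1 {S | ∀ i ≤ N, S i = a i} = m2 {S | ∀ i ≤ N, S i = a i}) :
    m1 = m2 := by
  have h1 : IsProjectiveLimit m1 (fun I : Finset ℕ => m1.map I.restrict) := fun I => rfl
  have h2 : IsProjectiveLimit m2 (fun I : Finset ℕ => m1.map I.restrict) := by
    rw [isProjectiveLimit_nat_iff]
    · intro n
      exact (aux_map_eq m1 m2 n (h n)).symm
    · intro I J hJI
      change m1.map J.restrict = (m1.map I.restrict).map (Finset.restrict₂ (π := fun _ => ℕ) hJI)
      rw [Measure.map_map (by fun_prop) (by fun_prop)]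
      rfl
  exact h1.unique h2

theorem aux_ext_past (m1 m2 : Measure Path) (N : ℕ)
    (h : ∀ a : Path, m1 {S | ∀ i ≤ N, S i = a i} = m2 {S | ∀ i ≤ N, S i = a i})
    (B : Set Path) (hB : MeasurableSet[Filtration.piLE (X := fun _ : ℕ => ℕ) N] B) :
    m1 B = m2 B := by
  rw [Filtration.piLE_eq_comap_frestrictLe] at hB
  obtain ⟨T, hT, rfl⟩ := hB
  have hm : Measurable (frestrictLe (π := fun _ : ℕ => ℕ) N) := measurable_frestrictLe N
  rw [← Measure.map_apply hm hT, ← Measure.map_apply hm hT, aux_map_eq m1 m2 N h]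

theorem aux_past_coord (N i c : ℕ) (hi : i ≤ N) :
    MeasurableSet[Filtration.piLE (X := fun _ : ℕ => ℕ) N] {S : Path | S i = c} := by
  rw [Filtration.piLE_eq_comap_frestrictLe]
  refine ⟨{t | t ⟨i, Finset.mem_Iic.2 hi⟩ = c}, ?_, ?_⟩
  · exact measurableSet_eq_fun (measurable_pi_apply _) measurable_const
  · rfl

theorem aux_cyl_meas (N : ℕ) (a : Path) : MeasurableSet {S : Path | ∀ i ≤ N, S i = a i} := by
  have : {S : Path | ∀ i ≤ N, S i = a i} = ⋂ i, ⋂ (_ : i ≤ N), {S | S i = a i} := by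
    ext S; simp
  rw [this]
  exact MeasurableSet.iInter fun i => MeasurableSet.iInter fun _ => aux_meas_coord i _

theorem aux_block_past (N k : ℕ) (b : Path) :
    MeasurableSet[Filtration.piLE (X := fun _ : ℕ => ℕ) (N + k)]
      {S : Path | ∀ i ≤ k, S (N + i) = b i} := by
  have : {S : Path | ∀ i ≤ k, S (N + i) = b i} = ⋂ i, ⋂ (_ : i ≤ k), {S | S (N + i) = b i} := by
    ext S; simp
  rw [this]
  exact MeasurableSet.iInter fun i => MeasurableSet.iInter fun hi =>
    aux_past_coord _ _ _ (by omega)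

theorem aux_mk1 (μ : Measure Path) (hμ : IsSMC μ) (N c b : ℕ) (B : Set Path)
    (hB : MeasurableSet[Filtration.piLE (X := fun _ : ℕ => ℕ) N] B) :
    μ {S | S N = c} * μ (B ∩ ({S | S N = c} ∩ {S | S (N + 1) = b})) =
      μ {S | S N = c ∧ S (N + 1) = b} * μ (B ∩ {S | S N = c}) := by
  obtain ⟨hp, -, hM⟩ := hμ
  have hBm : MeasurableSet B := Filtration.le _ _ _ hB
  have key := aux_ext_past
    (μ {S | S N = c} • μ.restrict ({S | S N = c} ∩ {S | S (N + 1) = b}))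
    (μ {S | S N = c ∧ S (N + 1) = b} • μ.restrict {S | S N = c}) N ?_ B hB
  · simpa [Measure.restrict_apply hBm] using key
  intro a
  simp only [Measure.smul_apply, smul_eq_mul, Measure.restrict_apply (aux_cyl_meas N a)]
  by_cases hac : a N = c
  · subst hac
    have e1 : {S : Path | ∀ i ≤ N, S i = a i} ∩ ({S | S N = a N} ∩ {S | S (N + 1) = b}) =
        {S | (∀ i ≤ N, S i = a i) ∧ S (N + 1) = b} := by
      ext S; simp only [Set.mem_inter_iff, Set.mem_ofPred_eq]
      exact ⟨fun h => ⟨h.1, h.2.2⟩, fun h => ⟨h.1, h.1 N le_rfl, h.2⟩⟩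
    have e2 : {S : Path | ∀ i ≤ N, S i = a i} ∩ {S | S N = a N} =
        {S | (∀ i ≤ N, S i = a i)} := by
      ext S; simp only [Set.mem_inter_iff, Set.mem_ofPred_eq]
      exact ⟨fun h => h.1, fun h => ⟨h, h N le_rfl⟩⟩
    rw [e1, e2]
    by_cases h0 : μ {S : Path | ∀ i ≤ N, S i = a i} = 0
    · rw [h0, measure_mono_null (s := {S : Path | (∀ i ≤ N, S i = a i) ∧ S (N + 1) = b})
        (fun S hS => hS.1) h0]; simp
    have hpos : 0 < pr μ {S : Path | ∀ i ≤ N, S i = a i} :=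
      ENNReal.toReal_pos h0 (measure_ne_top _ _)
    have hpos2 : 0 < pr μ {S : Path | S N = a N} := by
      refine ENNReal.toReal_pos (fun h => h0 ?_) (measure_ne_top _ _)
      exact measure_mono_null (fun S hS => hS N le_rfl) h
    have := hM N (Function.update a (N + 1) b) (by
      convert hpos using 5 with S i
      refine forall_congr' fun hi => ?_
      rw [Function.update_of_ne (by omega)])
    have hc : ∀ S : Path, (∀ i ≤ N, S i = Function.update a (N + 1) b i) ↔ ∀ i ≤ N, S i = a i := by
      intro S
      refine forall_congr' fun i => forall_congr' fun hi => ?_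
      rw [Function.update_of_ne (by omega)]
    simp only [hc, Function.update_self, Function.update_of_ne (show N ≠ N + 1 by omega)] at this
    rw [div_eq_div_iff hpos.ne' hpos2.ne'] at this
    rw [← ENNReal.toReal_eq_toReal_iff' (by finiteness) (by finiteness),
      ENNReal.toReal_mul, ENNReal.toReal_mul]
    unfold pr at this
    linarith
  · have e1 : {S : Path | ∀ i ≤ N, S i = a i} ∩ ({S | S N = c} ∩ {S | S (N + 1) = b}) = ∅ := by
      ext S; simp only [Set.mem_inter_iff, Set.mem_ofPred_eq, Set.mem_empty_iff_false, iff_false]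
      exact fun h => hac (h.1 N le_rfl ▸ h.2.1)
    have e2 : {S : Path | ∀ i ≤ N, S i = a i} ∩ {S | S N = c} = ∅ := by
      ext S; simp only [Set.mem_inter_iff, Set.mem_ofPred_eq, Set.mem_empty_iff_false, iff_false]
      exact fun h => hac (h.1 N le_rfl ▸ h.2)
    rw [e1, e2]; simp

theorem aux_mkv_cyl (μ : Measure Path) (hμ : IsSMC μ) (N c : ℕ) (B : Set Path)
    (hB : MeasurableSet[Filtration.piLE (X := fun _ : ℕ => ℕ) N] B) (k : ℕ) (b : Path) :
    μ {S | S N = c} * μ ({S | ∀ i ≤ k, S (N + i) = b i} ∩ (B ∩ {S | S N = c})) =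
      μ (B ∩ {S | S N = c}) * μ ({S | ∀ i ≤ k, S (N + i) = b i} ∩ {S | S N = c}) := by
  have hp := hμ.1
  induction k with
  | zero =>
    by_cases hbc : b 0 = c
    · have e1 : {S : Path | ∀ i ≤ 0, S (N + i) = b i} ∩ (B ∩ {S | S N = c}) = B ∩ {S | S N = c} := by
        ext S; simp [hbc]
      have e2 : {S : Path | ∀ i ≤ 0, S (N + i) = b i} ∩ ({S | S N = c}) = {S | S N = c} := by
        ext S; simp [hbc]
      rw [e1, e2, mul_comm]
    · have e1 : {S : Path | ∀ i ≤ 0, S (N + i) = b i} ∩ (B ∩ {S | S N = c}) = ∅ := by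
        ext S; simp; intro h _ h'; exact hbc (h ▸ h')
      have e2 : {S : Path | ∀ i ≤ 0, S (N + i) = b i} ∩ ({S | S N = c}) = ∅ := by
        ext S; simp; intro h h'; exact hbc (h ▸ h')
      rw [e1, e2]; simp
  | succ k ih =>
    have hmono : ∀ X, MeasurableSet[Filtration.piLE (X := fun _ : ℕ => ℕ) N] X →
        MeasurableSet[Filtration.piLE (X := fun _ : ℕ => ℕ) (N + k)] X :=
      fun X hX => Filtration.mono _ (Nat.le_add_right N k) _ hX
    have hc := aux_past_coord N N c le_rfl
    have hblk := aux_block_past N k b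
    have gen : ∀ X, MeasurableSet[Filtration.piLE (X := fun _ : ℕ => ℕ) N] X →
        μ {S | S (N + k) = b k} * μ ({S | ∀ i ≤ k + 1, S (N + i) = b i} ∩ X) =
        μ {S | S (N + k) = b k ∧ S (N + k + 1) = b (k + 1)} *
          μ ({S | ∀ i ≤ k, S (N + i) = b i} ∩ X) := by
      intro X hX
      have := aux_mk1 μ hμ (N + k) (b k) (b (k + 1)) _ (hblk.inter (hmono X hX))
      have e1 : {S : Path | ∀ i ≤ k, S (N + i) = b i} ∩ X ∩
          ({S | S (N + k) = b k} ∩ {S | S (N + k + 1) = b (k + 1)}) =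
          {S | ∀ i ≤ k + 1, S (N + i) = b i} ∩ X := by
        ext S
        simp only [Set.mem_inter_iff, Set.mem_ofPred_eq]
        constructor
        · rintro ⟨⟨h1, h2⟩, h3, h4⟩
          refine ⟨fun i hi => ?_, h2⟩
          rcases Nat.lt_or_ge k i with h | h
          · obtain rfl : i = k + 1 := by omega
            exact h4
          · exact h1 i h
        · rintro ⟨h1, h2⟩
          exact ⟨⟨fun i hi => h1 i (by omega), h2⟩, h1 k (by omega), h1 (k + 1) le_rfl⟩
      have e2 : {S : Path | ∀ i ≤ k, S (N + i) = b i} ∩ X ∩ {S | S (N + k) = b k} =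
          {S | ∀ i ≤ k, S (N + i) = b i} ∩ X := by
        ext S
        simp only [Set.mem_inter_iff, Set.mem_ofPred_eq]
        exact ⟨fun h => h.1, fun h => ⟨h, h.1 k le_rfl⟩⟩
      rwa [e1, e2] at this
    have g1 := gen _ (hB.inter hc)
    have g2 := gen _ hc
    by_cases hq : μ {S : Path | S (N + k) = b k} = 0
    · rw [measure_mono_null (s := {S : Path | ∀ i ≤ k + 1, S (N + i) = b i} ∩ (B ∩ {S | S N = c}))
          (fun S hS => hS.1 k (by omega)) hq,
        measure_mono_null (s := {S : Path | ∀ i ≤ k + 1, S (N + i) = b i} ∩ ({S | S N = c}))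
          (fun S hS => hS.1 k (by omega)) hq]
      simp
    · refine (ENNReal.mul_right_inj hq (measure_ne_top _ _)).1 ?_
      rw [mul_left_comm, g1, mul_left_comm, ih, mul_left_comm (μ {S | S (N + k) = b k}), g2]
      ring

theorem aux_mkv (μ : Measure Path) (hμ : IsSMC μ) (N c : ℕ) (B A : Set Path)
    (hB : MeasurableSet[Filtration.piLE (X := fun _ : ℕ => ℕ) N] B)
    (hA : MeasurableSet[MeasurableSpace.comap (fun (S : Path) (i : ℕ) => S (N + i)) inferInstance] A) :
    μ {S | S N = c} * μ (A ∩ (B ∩ {S | S N = c})) =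
      μ (B ∩ {S | S N = c}) * μ (A ∩ {S | S N = c}) := by
  have hp := hμ.1
  obtain ⟨T, hT, rfl⟩ := hA
  have hs : Measurable (fun (S : Path) (i : ℕ) => S (N + i)) := by fun_prop
  have h1 := Measure.smul_finite ((μ.restrict (B ∩ {S | S N = c})).map
    (fun (S : Path) (i : ℕ) => S (N + i))) (measure_ne_top μ {S | S N = c})
  have h2 := Measure.smul_finite ((μ.restrict ({S | S N = c})).map
    (fun (S : Path) (i : ℕ) => S (N + i))) (measure_ne_top μ (B ∩ {S | S N = c}))
  have key := aux_ext_path (μ {S | S N = c} • (μ.restrict (B ∩ {S | S N = c})).map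
      (fun (S : Path) (i : ℕ) => S (N + i))) (μ (B ∩ {S | S N = c}) •
        (μ.restrict ({S | S N = c})).map (fun (S : Path) (i : ℕ) => S (N + i))) (fun k b => by
    have := aux_mkv_cyl μ hμ N c B hB k b
    simp only [Measure.smul_apply, smul_eq_mul]
    rw [Measure.map_apply hs (aux_cyl_meas k b), Measure.map_apply hs (aux_cyl_meas k b),
      Measure.restrict_apply (hs (aux_cyl_meas k b)), Measure.restrict_apply (hs (aux_cyl_meas k b))]
    exact this)
  have := congrArg (fun m => m T) key
  simp only [Measure.smul_apply, smul_eq_mul] at this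
  rwa [Measure.map_apply hs hT, Measure.map_apply hs hT,
      Measure.restrict_apply (hs hT), Measure.restrict_apply (hs hT)] at this

theorem aux_stair_meas : MeasurableSet staircaseSet := by
  have : staircaseSet = (⋂ N, {S : Path | S N ≤ N}) ∩
      ⋂ N, ({S : Path | S (N + 1) = S N} ∪ {S | S (N + 1) = N + 1}) := by
    ext S; simp [staircaseSet]
  rw [this]
  refine MeasurableSet.inter (MeasurableSet.iInter fun N => ?_) (MeasurableSet.iInter fun N => ?_)
  · exact measurableSet_le (measurable_pi_apply N) measurable_const
  · exact (measurableSet_eq_fun (measurable_pi_apply (N + 1)) (measurable_pi_apply N)).union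
      (aux_meas_coord _ _)

theorem aux_stair_ae (μ : Measure Path) (hμ : IsSMC μ) : ∀ᵐ S ∂μ, S ∈ staircaseSet := by
  have := hμ.1
  exact (mem_ae_iff_prob_eq_one aux_stair_meas).2 hμ.2.1

theorem aux_Dpi (π : ℕ → ℕ → ℝ) (hπ : IsBalayage π) (m : Measure Path) [IsProbabilityMeasure m]
    (hs : ∀ᵐ S ∂m, S ∈ staircaseSet)
    (h : ∀ N a, a ≤ N → m.real ({S | S N = a} ∩ {S | S (N + 1) = N + 1}) =
      m.real {S | S (N + 1) = N + 1} * π N a) :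
    marginals m ∈ Dpi π := by
  have hrel : ∀ N a, a ≤ N → marginals m N a =
      marginals m (N + 1) a + marginals m (N + 1) (N + 1) * π N a := by
    intro N a ha
    change m.real {S | S N = a} = m.real {S | S (N + 1) = a} + m.real {S | S (N + 1) = N + 1} * π N a
    rw [← h N a ha, ← measureReal_union _ ((aux_meas_coord _ _).inter (aux_meas_coord _ _))]
    · apply measureReal_congr
      filter_upwards [hs] with S hS
      apply propext
      change S N = a ↔ (S (N + 1) = a ∨ (S N = a ∧ S (N + 1) = N + 1))
      rcases hS.2 N with h1 | h1
      · rw [h1]; tauto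
      · rw [h1]; constructor
        · intro h; right; exact ⟨h, rfl⟩
        · rintro (h | h)
          · omega
          · exact h.1
    · rw [Set.disjoint_left]
      intro S h1 h2
      have h1' : S (N + 1) = a := h1
      have h2' : S (N + 1) = N + 1 := h2.2
      omega
  refine ⟨⟨fun N a => ENNReal.toReal_nonneg, fun N a ha => ?_, fun N => ?_, fun N a ha => ?_⟩, hrel⟩
  · change m.real {S | S N = a} = 0
    rw [measureReal_eq_zero_iff]
    rw [measure_eq_zero_iff_ae_notMem]
    filter_upwards [hs] with S hS h
    have h' : S N = a := h
    have := hS.1 N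
    omega
  · change ∑ a ∈ Finset.range (N + 1), m.real ((fun S : Path => S N) ⁻¹' {a}) = 1
    rw [sum_measureReal_preimage_singleton _ (fun y _ => aux_meas_coord N y)]
    have : m ((fun S : Path => S N) ⁻¹' (Finset.range (N + 1) : Set ℕ)) = 1 := by
      rw [← mem_ae_iff_prob_eq_one ((measurable_pi_apply N) (MeasurableSet.of_discrete))]
      filter_upwards [hs] with S hS
      have := hS.1 N
      simp only [Set.mem_preimage, Finset.coe_range, Set.mem_Iio]
      omega
    rw [measureReal_def, this]
    simp
  · rw [hrel N a ha]
    have := mul_nonneg (show 0 ≤ marginals m (N + 1) (N + 1) from ENNReal.toReal_nonneg) (hπ.1 N a)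
    linarith

theorem aux_back (π : ℕ → ℕ → ℝ) (μ : Measure Path) (hμ : μ ∈ PMCpi π) (N a : ℕ) (ha : a ≤ N)
    (A : Set Path)
    (hA : MeasurableSet[MeasurableSpace.comap
      (fun (S : Path) (i : ℕ) => S (N + 1 + i)) inferInstance] A) :
    μ.real (A ∩ ({S | S N = a} ∩ {S | S (N + 1) = N + 1})) =
      μ.real (A ∩ {S | S (N + 1) = N + 1}) * π N a := by
  obtain ⟨hS, hb⟩ := hμ
  have hp := hS.1
  by_cases h0 : μ {S : Path | S (N + 1) = N + 1} = 0
  · rw [measureReal_def, measureReal_def,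
      measure_mono_null (s := A ∩ ({S | S N = a} ∩ {S | S (N + 1) = N + 1})) (fun S h => h.2.2) h0,
      measure_mono_null (s := A ∩ {S | S (N + 1) = N + 1}) (fun S h => h.2) h0]
    simp
  have hpos : 0 < μ.real {S : Path | S (N + 1) = N + 1} :=
    ENNReal.toReal_pos h0 (measure_ne_top _ _)
  have h1 := hb N a ha hpos
  have h2 := aux_mkv μ hS (N + 1) (N + 1) {S | S N = a} A (aux_past_coord _ _ _ (by omega)) hA
  have h3 := congrArg ENNReal.toReal h2
  rw [ENNReal.toReal_mul, ENNReal.toReal_mul] at h3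
  have h4 : μ.real ({S | S N = a} ∩ {S | S (N + 1) = N + 1}) / μ.real {S | S (N + 1) = N + 1}
    = π N a := h1
  rw [div_eq_iff hpos.ne'] at h4
  change μ.real {S | S (N + 1) = N + 1} *
    μ.real (A ∩ ({S | S N = a} ∩ {S | S (N + 1) = N + 1})) =
    μ.real ({S | S N = a} ∩ {S | S (N + 1) = N + 1}) * μ.real (A ∩ {S | S (N + 1) = N + 1}) at h3
  rw [h4] at h3
  apply mul_left_cancel₀ hpos.ne'
  rw [h3]; ring

theorem aux_tail_shift (A : Set Path) (hA : MeasurableSet[pathTail] A) (N : ℕ) :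
    MeasurableSet[MeasurableSpace.comap
      (fun (S : Path) (i : ℕ) => S (N + i)) inferInstance] A := by
  unfold pathTail at hA
  rw [MeasurableSpace.measurableSet_iInf] at hA
  exact hA N

theorem aux_tail_meas (A : Set Path) (hA : MeasurableSet[pathTail] A) : MeasurableSet A := by
  have := aux_tail_shift A hA 0
  exact (Measurable.comap_le (by fun_prop)) _ this

theorem aux_cyl_past (N : ℕ) (b : Path) :
    MeasurableSet[Filtration.piLE (X := fun _ : ℕ => ℕ) N]
      {S : Path | ∀ i ≤ N, S i = b i} := by
  have : {S : Path | ∀ i ≤ N, S i = b i} = ⋂ i, ⋂ (_ : i ≤ N), {S | S i = b i} := by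
    ext S; simp
  rw [this]
  exact MeasurableSet.iInter fun i => MeasurableSet.iInter fun hi =>
    aux_past_coord _ _ _ hi

theorem aux_cond_real (μ : Measure Path) {A : Set Path} (hA : MeasurableSet A) (B : Set Path) :
    (ProbabilityTheory.cond μ A).real B = (μ.real A)⁻¹ * μ.real (A ∩ B) := by
  simp only [measureReal_def]
  rw [ProbabilityTheory.cond_apply hA, ENNReal.toReal_mul, ENNReal.toReal_inv]

theorem aux_cond_mem (π : ℕ → ℕ → ℝ) (hπ : IsBalayage π) (μ : Measure Path) (hμ : μ ∈ PMCpi π)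
    (A : Set Path) (hA : MeasurableSet[pathTail] A) (h0 : μ A ≠ 0) :
    marginals (ProbabilityTheory.cond μ A) ∈ Dpi π := by
  have hp := hμ.1.1
  have := ProbabilityTheory.cond_isProbabilityMeasure h0
  apply aux_Dpi π hπ
  · exact ProbabilityTheory.cond_absolutelyContinuous.ae_le (aux_stair_ae μ hμ.1)
  · intro N a ha
    rw [aux_cond_real μ (aux_tail_meas A hA),
      aux_cond_real μ (aux_tail_meas A hA),
      aux_back π μ hμ N a ha A (aux_tail_shift A hA _), mul_assoc]

theorem aux_mem (π : ℕ → ℕ → ℝ) (hπ : IsBalayage π) (μ : Measure Path) (hμ : μ ∈ PMCpi π) :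
    marginals μ ∈ Dpi π := by
  have hp := hμ.1.1
  have := aux_cond_mem π hπ μ hμ Set.univ MeasurableSet.univ (by simp)
  rwa [ProbabilityTheory.cond_univ] at this

theorem aux_rev (π : ℕ → ℕ → ℝ) (hπ : IsBalayage π) (μ : Measure Path) (hμ : μ ∈ PMCpi π)
    (hE : marginals μ ∈ Set.extremePoints ℝ (Dpi π)) : HasTrivialTail μ := by
  intro A hA
  have hp := hμ.1.1
  have hAm := aux_tail_meas A hA
  by_contra! hcon
  obtain ⟨h0, h1⟩ := hcon
  have h0c : μ Aᶜ ≠ 0 := by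
    intro h
    exact h1 ((prob_compl_eq_zero_iff hAm).1 h)
  have hpos : 0 < μ.real A := ENNReal.toReal_pos h0 (measure_ne_top _ _)
  have hposc : 0 < μ.real Aᶜ := ENNReal.toReal_pos h0c (measure_ne_top _ _)
  have hE2 := hE.2 (aux_cond_mem π hπ μ hμ A hA h0)
    (aux_cond_mem π hπ μ hμ Aᶜ (MeasurableSet.compl hA) h0c)
    ⟨μ.real A, μ.real Aᶜ, hpos, hposc, by
      rw [probReal_compl_eq_one_sub hAm]; ring, by
      funext N a
      change μ.real A * (ProbabilityTheory.cond μ A).real {S | S N = a} +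
        μ.real Aᶜ * (ProbabilityTheory.cond μ Aᶜ).real {S | S N = a} = μ.real {S | S N = a}
      rw [aux_cond_real μ hAm, aux_cond_real μ hAm.compl,
        mul_inv_cancel_left₀ hpos.ne', mul_inv_cancel_left₀ hposc.ne', Set.inter_comm,
        Set.inter_comm Aᶜ, ← Set.sdiff_eq, measureReal_inter_add_sdiff hAm]⟩
  have hind : ∀ N a, μ (A ∩ {S | S N = a}) = μ A * μ {S | S N = a} := by
    intro N a
    have := congrFun (congrFun hE2 N) a
    change (ProbabilityTheory.cond μ A).real {S | S N = a} = μ.real {S | S N = a} at this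
    rw [aux_cond_real μ hAm, inv_mul_eq_iff_eq_mul₀ hpos.ne'] at this
    rw [← ENNReal.toReal_eq_toReal_iff' (by finiteness) (by finiteness), ENNReal.toReal_mul]
    exact this
  have hfin := Measure.smul_finite μ (measure_ne_top μ A)
  have hext := aux_ext_path (μ.restrict A) (μ A • μ) (fun N a => by
    rw [Measure.restrict_apply (aux_cyl_meas N a), Measure.smul_apply, smul_eq_mul]
    have hc : MeasurableSet[Filtration.piLE (X := fun _ : ℕ => ℕ) N]
        {S : Path | ∀ i ≤ N, S i = a i} := by
      exact aux_cyl_past N a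
    have := aux_mkv μ hμ.1 N (a N) _ A hc (aux_tail_shift A hA N)
    have e2 : {S : Path | ∀ i ≤ N, S i = a i} ∩ {S | S N = a N} =
        {S | (∀ i ≤ N, S i = a i)} := by
      ext S; simp only [Set.mem_inter_iff, Set.mem_ofPred_eq]
      exact ⟨fun h => h.1, fun h => ⟨h, h N le_rfl⟩⟩
    rw [e2, hind] at this
    rw [Set.inter_comm]
    by_cases hq : μ {S : Path | S N = a N} = 0
    · rw [measure_mono_null (s := A ∩ {S : Path | ∀ i ≤ N, S i = a i})
          (fun S hS => hS.2 N le_rfl) hq,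
        measure_mono_null (s := {S : Path | ∀ i ≤ N, S i = a i})
          (fun S hS => hS N le_rfl) hq]
      simp
    · refine (ENNReal.mul_right_inj hq (measure_ne_top _ _)).1 ?_
      rw [this]; ring)
  have hAA := congrArg (fun m => (m A).toReal) hext
  simp only [Measure.restrict_apply_self, Measure.smul_apply, smul_eq_mul, ENNReal.toReal_mul] at hAA
  have : μ.real A = 1 := by
    have h : μ.real A = μ.real A * μ.real A := hAA
    have := mul_left_cancel₀ hpos.ne' ((mul_one _).trans h)
    exact this.symm
  apply h1
  rw [← ENNReal.toReal_eq_toReal_iff' (by finiteness) (by finiteness)]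
  exact this

theorem aux_set_const (μ : Measure Path) (n y : ℕ) (h : ℕ → ℝ) (C : Set Path)
    (hC : MeasurableSet C) (hs : C ⊆ {S | S n = y}) :
    ∫ S in C, h (S n) ∂μ = μ.real C * h y := by
  have : ∫ S in C, h (S n) ∂μ = ∫ _ in C, h y ∂μ := by
    apply setIntegral_congr_fun hC
    intro S hS
    have : S n = y := hs hS
    simp only [this]
  rw [this, setIntegral_const, smul_eq_mul]

theorem aux_cyl_step (π : ℕ → ℕ → ℝ) (hπ : IsBalayage π) (μ : Measure Path) (hμ : μ ∈ PMCpi π)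
    (ν : ℕ → ℕ → ℝ) (hν : ν ∈ Dpi π) (hdom : ∀ N a, marginals μ N a = 0 → ν N a = 0)
    (hint : ∀ n, Integrable (fun S : Path => ν n (S n) / marginals μ n (S n)) μ)
    (N : ℕ) (a : Path) :
    ∫ S in {S | ∀ i ≤ N, S i = a i}, ν N (S N) / marginals μ N (S N) ∂μ =
      ∫ S in {S | ∀ i ≤ N, S i = a i}, ν (N + 1) (S (N + 1)) / marginals μ (N + 1) (S (N + 1)) ∂μ := by
  have hp := hμ.1.1
  have hst := aux_stair_ae μ hμ.1
  set C : Set Path := {S | ∀ i ≤ N, S i = a i} with hCdef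
  have hCm : MeasurableSet C := aux_cyl_meas N a
  by_cases h0 : μ C = 0
  · rw [setIntegral_measure_zero _ h0, setIntegral_measure_zero _ h0]
  have hCsub : C ⊆ {S | S N = a N} := fun S hS => hS N le_rfl
  have hq0 : μ {S : Path | S N = a N} ≠ 0 := fun h => h0 (measure_mono_null hCsub h)
  have hq : 0 < μ.real {S : Path | S N = a N} := ENNReal.toReal_pos hq0 (measure_ne_top _ _)
  have haN : a N ≤ N := by
    by_contra hlt
    push Not at hlt
    have := (aux_mem π hπ μ hμ).1.2.1 N (a N) hlt
    exact hq.ne' this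
  set C1 : Set Path := C ∩ {S | S (N + 1) = a N} with hC1
  set C2 : Set Path := C ∩ {S | S (N + 1) = N + 1} with hC2
  have hC1m : MeasurableSet C1 := hCm.inter (aux_meas_coord _ _)
  have hC2m : MeasurableSet C2 := hCm.inter (aux_meas_coord _ _)
  have hun : C =ᵐ[μ] (C1 ∪ C2 : Set Path) := by
    filter_upwards [hst] with S hS
    apply propext
    change S ∈ C ↔ S ∈ C1 ∪ C2
    constructor
    · intro h
      rcases hS.2 N with h1 | h1
      · left; exact ⟨h, h1.trans (h N le_rfl)⟩
      · right; exact ⟨h, h1⟩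
    · rintro (h | h)
      · exact h.1
      · exact h.1
  have hdisj : Disjoint C1 C2 := by
    rw [Set.disjoint_left]
    intro S h1 h2
    have h1' : S (N + 1) = a N := h1.2
    have h2' : S (N + 1) = N + 1 := h2.2
    omega
  rw [aux_set_const μ N (a N) (fun y => ν N y / marginals μ N y) C hCm hCsub,
    setIntegral_congr_set hun, setIntegral_union hdisj hC2m (hint _).integrableOn (hint _).integrableOn,
    aux_set_const μ (N + 1) (a N) (fun y => ν (N + 1) y / marginals μ (N + 1) y) C1 hC1m
      (fun S hS => hS.2),
    aux_set_const μ (N + 1) (N + 1) (fun y => ν (N + 1) y / marginals μ (N + 1) y) C2 hC2m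
      (fun S hS => hS.2)]
  have step : ∀ b, μ.real {S | S N = a N} * μ.real (C ∩ {S | S (N + 1) = b}) =
      μ.real ({S | S N = a N} ∩ {S | S (N + 1) = b}) * μ.real C := by
    intro b
    have h := congrArg ENNReal.toReal
      (aux_mk1 μ hμ.1 N (a N) b C (aux_cyl_past N a))
    rw [← Set.inter_assoc, Set.inter_eq_left.2 hCsub, ENNReal.toReal_mul, ENNReal.toReal_mul] at h
    exact h
  have k1 : μ.real ({S | S N = a N} ∩ {S | S (N + 1) = a N}) = marginals μ (N + 1) (a N) := by
    change _ = μ.real {S | S (N + 1) = a N}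
    apply measureReal_congr
    filter_upwards [hst] with S hS
    apply propext
    change (S N = a N ∧ S (N + 1) = a N) ↔ S (N + 1) = a N
    rcases hS.2 N with h1 | h1
    · rw [h1]; tauto
    · rw [h1]; constructor
      · exact fun h => h.2
      · intro h; omega
  have k2 : μ.real ({S | S N = a N} ∩ {S | S (N + 1) = N + 1}) =
      marginals μ (N + 1) (N + 1) * π N (a N) := by
    have := aux_back π μ hμ N (a N) haN Set.univ MeasurableSet.univ
    rw [Set.univ_inter, Set.univ_inter] at this
    exact this
  have s1 := step (a N)
  have s2 := step (N + 1)
  rw [k1] at s1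
  rw [k2] at s2
  have d : ∀ n y, marginals μ n y * (ν n y / marginals μ n y) = ν n y := by
    intro n y
    by_cases h : marginals μ n y = 0
    · rw [h, hdom n y h]; simp
    · field_simp
  have hr := hν.2 N (a N) haN
  apply mul_left_cancel₀ hq.ne'
  have e0 : μ.real {S | S N = a N} * (ν N (a N) / marginals μ N (a N)) = ν N (a N) := d N (a N)
  calc μ.real {S | S N = a N} * (μ.real C * (ν N (a N) / marginals μ N (a N)))
      = μ.real C * ν N (a N) := by rw [mul_left_comm, e0]
    _ = μ.real C * (ν (N + 1) (a N) + ν (N + 1) (N + 1) * π N (a N)) := by rw [hr]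
    _ = μ.real C * (marginals μ (N + 1) (a N) * (ν (N + 1) (a N) / marginals μ (N + 1) (a N)) +
          (marginals μ (N + 1) (N + 1) * (ν (N + 1) (N + 1) / marginals μ (N + 1) (N + 1)))
            * π N (a N)) := by rw [d, d]
    _ = (marginals μ (N + 1) (a N) * μ.real C) * (ν (N + 1) (a N) / marginals μ (N + 1) (a N)) +
        (marginals μ (N + 1) (N + 1) * π N (a N) * μ.real C) *
          (ν (N + 1) (N + 1) / marginals μ (N + 1) (N + 1)) := by ring
    _ = _ := by rw [← s1, ← s2]; ring

theorem aux_meas_M (h : ℕ → ℝ) (n : ℕ) : Measurable (fun S : Path => h (S n)) :=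
  (measurable_of_countable h).comp (measurable_pi_apply n)

theorem aux_martingale (π : ℕ → ℕ → ℝ) (hπ : IsBalayage π) (μ : Measure Path) (hμ : μ ∈ PMCpi π)
    (ν : ℕ → ℕ → ℝ) (hν : ν ∈ Dpi π) (hdom : ∀ N a, marginals μ N a = 0 → ν N a = 0)
    (hint : ∀ n, Integrable (fun S : Path => ν n (S n) / marginals μ n (S n)) μ) :
    Martingale (fun n (S : Path) => ν n (S n) / marginals μ n (S n))
      (Filtration.piLE (X := fun _ : ℕ => ℕ)) μ := by
  have hp := hμ.1.1
  have hnn : ∀ n (S : Path), 0 ≤ ν n (S n) / marginals μ n (S n) := fun n S =>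
    div_nonneg (hν.1.1 _ _) ENNReal.toReal_nonneg
  refine martingale_of_setIntegral_eq_succ ?_ hint ?_
  · intro n
    have : Measurable[Filtration.piLE (X := fun _ : ℕ => ℕ) n]
        (fun S : Path => S n) := by
      refine @measurable_to_countable' ℕ Path _ _ (Filtration.piLE (X := fun _ : ℕ => ℕ) n) _ ?_
      intro x
      exact aux_past_coord n n x le_rfl
    exact ((measurable_of_countable (fun y => ν n y / marginals μ n y)).comp this).stronglyMeasurable
  · intro N B hB
    have hBm : MeasurableSet B := Filtration.le _ _ _ hB
    have wd : ∀ n (C : Set Path), MeasurableSet C →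
        (μ.withDensity (fun S => ENNReal.ofReal (ν n (S n) / marginals μ n (S n)))) C =
        ENNReal.ofReal (∫ S in C, ν n (S n) / marginals μ n (S n) ∂μ) := by
      intro n C hC
      rw [withDensity_apply _ hC, ofReal_integral_eq_lintegral_ofReal (hint n).integrableOn
        (ae_of_all _ (hnn n))]
    have := aux_ext_past
      (μ.withDensity (fun S => ENNReal.ofReal (ν N (S N) / marginals μ N (S N))))
      (μ.withDensity (fun S =>
        ENNReal.ofReal (ν (N + 1) (S (N + 1)) / marginals μ (N + 1) (S (N + 1))))) N
      (fun a => by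
        rw [wd N _ (aux_cyl_meas N a), wd (N + 1) _ (aux_cyl_meas N a),
          aux_cyl_step π hπ μ hμ ν hν hdom hint N a]) B hB
    rw [wd N _ hBm, wd (N + 1) _ hBm] at this
    exact (ENNReal.ofReal_eq_ofReal_iff (integral_nonneg (hnn N))
      (integral_nonneg (hnn (N + 1)))).1 this

theorem aux_limsup_tail (h : ℕ → ℕ → ℝ) (U : Set ℝ) (hU : MeasurableSet U) :
    MeasurableSet[pathTail] ((fun S : Path => limsup (fun n => h n (S n)) atTop) ⁻¹' U) := by
  unfold pathTail
  rw [MeasurableSpace.measurableSet_iInf]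
  intro N
  refine ⟨(fun T : Path => limsup (fun n => h (n + N) (T n)) atTop) ⁻¹' U, ?_, ?_⟩
  · exact (Measurable.limsup fun n => aux_meas_M (h (n + N)) n) hU
  · ext S
    simp only [Set.mem_preimage]
    rw [← limsup_nat_add (fun n => h n (S n)) N]
    simp only [Nat.add_comm N]

theorem aux_fwd (π : ℕ → ℕ → ℝ) (hπ : IsBalayage π) (μ : Measure Path) (hμ : μ ∈ PMCpi π)
    (hT : HasTrivialTail μ) : marginals μ ∈ Set.extremePoints ℝ (Dpi π) := by
  have hp := hμ.1.1
  have hmem := aux_mem π hπ μ hμ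
  refine ⟨hmem, ?_⟩
  rintro ν hν ν2 hν2 ⟨s, t, hs, ht, hst, heq⟩
  have hle : ∀ N a, s * ν N a ≤ marginals μ N a := by
    intro N a
    rw [← heq]
    have := mul_nonneg ht.le (hν2.1.1 N a)
    change s * ν N a ≤ s * ν N a + t * ν2 N a
    linarith
  have hdom : ∀ N a, marginals μ N a = 0 → ν N a = 0 := by
    intro N a h
    have h1 := hle N a
    rw [h] at h1
    have h2 := hν.1.1 N a
    nlinarith
  have hnn : ∀ n (S : Path), 0 ≤ ν n (S n) / marginals μ n (S n) := fun n S =>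
    div_nonneg (hν.1.1 _ _) ENNReal.toReal_nonneg
  have hbd : ∀ n (S : Path), ‖ν n (S n) / marginals μ n (S n)‖ ≤ s⁻¹ := by
    intro n S
    rw [Real.norm_of_nonneg (hnn n S)]
    apply div_le_of_le_mul₀ (hmem.1.1 _ _) (by positivity)
    have := hle n (S n)
    rw [le_inv_mul_iff₀ hs]
    exact this
  have hmeas : ∀ n, Measurable (fun S : Path => ν n (S n) / marginals μ n (S n)) :=
    fun n => aux_meas_M (fun y => ν n y / marginals μ n y) n
  have hint : ∀ n, Integrable (fun S : Path => ν n (S n) / marginals μ n (S n)) μ := fun n =>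
    Integrable.of_bound (hmeas n).aestronglyMeasurable s⁻¹ (ae_of_all _ (hbd n))
  have hmart := aux_martingale π hπ μ hμ ν hν hdom hint
  have hconv := hmart.submartingale.ae_tendsto_limitProcess (R := s⁻¹.toNNReal) (fun n => by
    refine (eLpNorm_le_of_ae_bound (ae_of_all _ (hbd n))).trans ?_
    simp [ENNReal.ofReal])
  obtain ⟨c, hc⟩ := exists_eventuallyEq_const_of_forall_separating (l := ae μ)
    (f := fun S : Path => limsup (fun n => ν n (S n) / marginals μ n (S n)) atTop)
    MeasurableSet (fun U hU => by
      have hm := aux_limsup_tail (fun n y => ν n y / marginals μ n y) U hU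
      have hm' := aux_tail_meas _ hm
      rcases hT _ hm with h | h
      · right
        exact measure_eq_zero_iff_ae_notMem.1 h
      · left
        exact (mem_ae_iff_prob_eq_one hm').2 h)
  have hlim : ∀ᵐ S ∂μ, Tendsto (fun n => ν n (S n) / marginals μ n (S n)) atTop (nhds c) := by
    filter_upwards [hconv, hc] with S h1 h2
    have h3 := h1.limsup_eq
    have h4 : limsup (fun n => ν n (S n) / marginals μ n (S n)) atTop = c := h2
    rw [← h4, h3]
    exact h1
  have hval : ∀ N a, ν N a = marginals μ N a * c := by
    intro N a
    have hAm := aux_meas_coord N a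
    have l1 : Tendsto (fun n => ∫ S in {S : Path | S N = a}, ν n (S n) / marginals μ n (S n) ∂μ)
        atTop (nhds (∫ _ in {S : Path | S N = a}, c ∂μ)) := by
      refine tendsto_integral_of_dominated_convergence (fun _ => s⁻¹)
        (fun n => (hmeas n).aestronglyMeasurable) (integrable_const _)
        (fun n => ae_of_all _ (hbd n)) (ae_restrict_of_ae hlim)
    have l2 : Tendsto (fun n => ∫ S in {S : Path | S N = a}, ν n (S n) / marginals μ n (S n) ∂μ)
        atTop (nhds (ν N a)) := by
      refine tendsto_const_nhds.congr' ?_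
      filter_upwards [eventually_ge_atTop N] with n hn
      have := hmart.setIntegral_eq hn (aux_past_coord N N a le_rfl)
      rw [← this, aux_set_const μ N a (fun y => ν N y / marginals μ N y) _ hAm subset_rfl]
      change _ = marginals μ N a * (ν N a / marginals μ N a)
      by_cases h : marginals μ N a = 0
      · rw [h, hdom N a h]; simp
      · field_simp
    have := tendsto_nhds_unique l2 l1
    rw [this, setIntegral_const, smul_eq_mul]
    rfl
  have hc1 : c = 1 := by
    have h1 := hν.1.2.2.1 0
    have h2 := hmem.1.2.2.1 0
    simp only [hval, ← Finset.sum_mul] at h1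
    rw [h2] at h1
    linarith
  funext N a
  rw [hval, hc1, mul_one]

/-- a staircase Markov chain with backwards transition probabilities `π` has a
trivial tail σ-algebra iff its sequence of marginals is an extreme point of `𝒟(π)`. -/
theorem statement5 (π : ℕ → ℕ → ℝ) (hπ : IsBalayage π) (μ : Measure Path)
    (hμ : μ ∈ PMCpi π) :
    HasTrivialTail μ ↔ marginals μ ∈ Set.extremePoints ℝ (Dpi π) :=
  ⟨aux_fwd π hπ μ hμ, aux_rev π hπ μ hμ⟩

end VMCPaper
end

section
/- For every balayage π, the set 𝒟(π) is a Choquet simplex (as a compact convex subset of the locally convex space ∏_{N∈ℕ} ℝ^{N+1}). -/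
open MeasureTheory Filter
open scoped ENNReal NNReal

namespace VMCPaper

section Helpers

open Topology

theorem mem_Dpi_iff {π : ℕ → ℕ → ℝ} (hπ : IsBalayage π) (ν : ℕ → ℕ → ℝ) :
    ν ∈ Dpi π ↔ (∀ N a, 0 ≤ ν N a) ∧ (∀ N a, N < a → ν N a = 0) ∧
      (∀ N, ∑ a ∈ Finset.range (N + 1), ν N a = 1) ∧
      ∀ N a, a ≤ N → ν N a = ν (N + 1) a + ν (N + 1) (N + 1) * π N a := by
  constructor
  · rintro ⟨⟨h1, h2, h3, h4⟩, h5⟩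
    exact ⟨h1, h2, h3, h5⟩
  · rintro ⟨h1, h2, h3, h5⟩
    refine ⟨⟨h1, h2, h3, fun N a ha => ?_⟩, h5⟩
    rw [h5 N a ha]
    have := mul_nonneg (h1 (N+1) (N+1)) (hπ.1 N a)
    linarith

/-- The vertex `e a`. -/
noncomputable def vtx (π : ℕ → ℕ → ℝ) (a N c : ℕ) : ℝ :=
  if a ≤ N then (if c = a then 1 else 0)
  else ∑ b : Fin a, π (a - 1) b * vtx π b N c
termination_by a
decreasing_by exact b.2

theorem vtx_le (π : ℕ → ℕ → ℝ) {a N : ℕ} (h : a ≤ N) (c : ℕ) :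
    vtx π a N c = if c = a then 1 else 0 := by
  rw [vtx, if_pos h]

theorem vtx_succ (π : ℕ → ℕ → ℝ) {n N : ℕ} (h : N ≤ n) (c : ℕ) :
    vtx π (n + 1) N c = ∑ b ∈ Finset.range (n + 1), π n b * vtx π b N c := by
  rw [vtx, if_neg (by omega), Finset.sum_range]
  rfl

theorem vtx_mem {π : ℕ → ℕ → ℝ} (hπ : IsBalayage π) (a : ℕ) : vtx π a ∈ Dpi π := by
  rw [mem_Dpi_iff hπ]
  have h1 : ∀ a N c, 0 ≤ vtx π a N c := by
    intro a
    induction a using Nat.strong_induction_on with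
    | _ a ih =>
      intro N c
      by_cases h : a ≤ N
      · rw [vtx_le π h]; split_ifs <;> norm_num
      · obtain ⟨n, rfl⟩ : ∃ n, a = n + 1 := ⟨a - 1, by omega⟩
        rw [vtx_succ π (by omega)]
        refine Finset.sum_nonneg fun b hb => mul_nonneg (hπ.1 _ _) (ih b ?_ _ _)
        simpa using hb
  have h2 : ∀ a N c, N < c → vtx π a N c = 0 := by
    intro a
    induction a using Nat.strong_induction_on with
    | _ a ih =>
      intro N c hc
      by_cases h : a ≤ N
      · rw [vtx_le π h, if_neg (by omega)]
      · obtain ⟨n, rfl⟩ : ∃ n, a = n + 1 := ⟨a - 1, by omega⟩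
        rw [vtx_succ π (by omega)]
        refine Finset.sum_eq_zero fun b hb => ?_
        rw [ih b (by simpa using hb) _ _ hc, mul_zero]
  have h3 : ∀ a N, ∑ c ∈ Finset.range (N + 1), vtx π a N c = 1 := by
    intro a
    induction a using Nat.strong_induction_on with
    | _ a ih =>
      intro N
      by_cases h : a ≤ N
      · simp only [vtx_le π h]
        rw [Finset.sum_ite_eq', if_pos (by simp; omega)]
      · obtain ⟨n, rfl⟩ : ∃ n, a = n + 1 := ⟨a - 1, by omega⟩
        simp only [vtx_succ π (show N ≤ n by omega)]
        rw [Finset.sum_comm, ← hπ.2.2 n]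
        refine Finset.sum_congr rfl fun b hb => ?_
        rw [← Finset.mul_sum, ih b (by simpa using hb), mul_one]
  refine ⟨h1 a, h2 a, h3 a, ?_⟩
  induction a using Nat.strong_induction_on with
  | _ a ih =>
    intro N c hc
    rcases lt_trichotomy a (N + 1) with h | h | h
    · rw [vtx_le π (by omega), vtx_le π (by omega), vtx_le π (by omega),
        if_neg (show N + 1 ≠ a by omega)]
      ring
    · subst h
      rw [vtx_succ π le_rfl, vtx_le π le_rfl, vtx_le π le_rfl, if_neg (by omega), if_pos rfl]
      rw [Finset.sum_eq_single c]
      · rw [vtx_le π hc, if_pos rfl]; ring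
      · intro b hb hbc
        rw [vtx_le π (by simp at hb; omega), if_neg (by omega), mul_zero]
      · intro h; simp at h; omega
    · obtain ⟨n, rfl⟩ : ∃ n, a = n + 1 := ⟨a - 1, by omega⟩
      rw [vtx_succ π (by omega), vtx_succ π (by omega), vtx_succ π (by omega),
        Finset.sum_mul, ← Finset.sum_add_distrib]
      refine Finset.sum_congr rfl fun b hb => ?_
      rw [ih b (by simpa using hb) N c hc]
      ring

theorem vtx_sum {π : ℕ → ℕ → ℝ} {y : ℕ → ℕ → ℝ} (hy : y ∈ Dpi π) {k n : ℕ} (hkn : k ≤ n)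
    (c : ℕ) : ∑ a ∈ Finset.range (n + 1), y n a * vtx π a k c = y k c := by
  obtain ⟨⟨h1, h2, h3, h4⟩, h5⟩ := hy
  induction n, hkn using Nat.le_induction with
  | base =>
    by_cases hc : c ≤ k
    · rw [Finset.sum_eq_single c]
      · rw [vtx_le π hc, if_pos rfl, mul_one]
      · intro b hb hbc
        rw [vtx_le π (by simp at hb; omega), if_neg (by omega), mul_zero]
      · intro h; simp at h; omega
    · rw [h2 k c (by omega)]
      refine Finset.sum_eq_zero fun b hb => ?_
      simp at hb
      rw [vtx_le π (by omega), if_neg (by omega), mul_zero]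
  | succ n hn ih =>
    rw [← ih, Finset.sum_range_succ, vtx_succ π hn, Finset.mul_sum, ← Finset.sum_add_distrib]
    refine Finset.sum_congr rfl fun b hb => ?_
    rw [h5 n b (by simp at hb; omega)]
    ring

theorem Dpi_le_one {π : ℕ → ℕ → ℝ} {y : ℕ → ℕ → ℝ} (hy : y ∈ Dpi π) (n a : ℕ) : y n a ≤ 1 := by
  obtain ⟨⟨h1, h2, h3, h4⟩, h5⟩ := hy
  by_cases h : n < a
  · rw [h2 n a h]; norm_num
  · rw [← h3 n]
    exact Finset.single_le_sum (f := fun a => y n a) (fun b _ => h1 n b) (by simp; omega)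

theorem Dpi_isClosed {π : ℕ → ℕ → ℝ} (hπ : IsBalayage π) : IsClosed (Dpi π) := by
  have : Dpi π = {ν | (∀ N a, 0 ≤ ν N a) ∧ (∀ N a, N < a → ν N a = 0) ∧
      (∀ N, ∑ a ∈ Finset.range (N + 1), ν N a = 1) ∧
      ∀ N a, a ≤ N → ν N a = ν (N + 1) a + ν (N + 1) (N + 1) * π N a} :=
    Set.ext (mem_Dpi_iff hπ)
  rw [this]
  have hc : ∀ N a, Continuous fun ν : ℕ → ℕ → ℝ => ν N a := fun N a => by fun_prop
  simp only [Set.setOf_and, Set.setOf_forall]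
  refine .inter ?_ (.inter ?_ (.inter ?_ ?_))
  · exact isClosed_iInter fun N => isClosed_iInter fun a => isClosed_le continuous_const (hc N a)
  · exact isClosed_iInter fun N => isClosed_iInter fun a => isClosed_iInter fun _ =>
      isClosed_eq (hc N a) continuous_const
  · exact isClosed_iInter fun N =>
      isClosed_eq (continuous_finset_sum _ fun a _ => hc N a) continuous_const
  · exact isClosed_iInter fun N => isClosed_iInter fun a => isClosed_iInter fun _ =>
      isClosed_eq (hc N a) ((hc _ _).add ((hc _ _).mul continuous_const))

theorem Dpi_isCompact {π : ℕ → ℕ → ℝ} (hπ : IsBalayage π) : IsCompact (Dpi π) := by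
  have h : IsCompact (Set.pi Set.univ fun _ : ℕ => Set.pi Set.univ fun _ : ℕ =>
      Set.Icc (0 : ℝ) 1) :=
    isCompact_univ_pi fun _ => isCompact_univ_pi fun _ => isCompact_Icc
  refine h.of_isClosed_subset (Dpi_isClosed hπ) fun y hy => ?_
  intro n _ a _
  exact ⟨hy.1.1 n a, Dpi_le_one hy n a⟩

theorem Dpi_convex {π : ℕ → ℕ → ℝ} (hπ : IsBalayage π) : Convex ℝ (Dpi π) := by
  intro x hx y hy s t hs ht hst
  rw [mem_Dpi_iff hπ] at *
  obtain ⟨a1, a2, a3, a4⟩ := hx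
  obtain ⟨b1, b2, b3, b4⟩ := hy
  simp only [Pi.add_apply, Pi.smul_apply, smul_eq_mul]
  refine ⟨fun N a => ?_, fun N a h => ?_, fun N => ?_, fun N a h => ?_⟩
  · have := a1 N a; have := b1 N a; positivity
  · rw [a2 N a h, b2 N a h]; ring
  · rw [Finset.sum_add_distrib, ← Finset.mul_sum, ← Finset.mul_sum, a3, b3]; linarith
  · rw [a4 N a h, b4 N a h]; ring

/-- The vertices as points of the subtype. -/
noncomputable def vtxK {π : ℕ → ℕ → ℝ} (hπ : IsBalayage π) (a : ℕ) : Dpi π :=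
  ⟨vtx π a, vtx_mem hπ a⟩

/-- Approximating measures. -/
noncomputable def appr {π : ℕ → ℕ → ℝ} (hπ : IsBalayage π) (x : Dpi π) (n : ℕ) :
    ProbabilityMeasure (Dpi π) :=
  ⟨∑ a ∈ Finset.range (n + 1), ENNReal.ofReal (x.1 n a) • Measure.dirac (vtxK hπ a), ⟨by
    simp only [Measure.coe_finset_sum, Finset.sum_apply, Measure.smul_apply, measure_univ,
      smul_eq_mul, mul_one]
    rw [← ENNReal.ofReal_sum_of_nonneg fun a _ => x.2.1.1 n a, x.2.1.2.2.1 n, ENNReal.ofReal_one]⟩⟩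

theorem integral_appr {π : ℕ → ℕ → ℝ} (hπ : IsBalayage π) (x : Dpi π) (n : ℕ)
    (g : Dpi π → ℝ) (hg : Continuous g) :
    ∫ z, g z ∂(appr hπ x n : Measure (Dpi π)) =
      ∑ a ∈ Finset.range (n + 1), x.1 n a * g (vtxK hπ a) := by
  show ∫ z, g z ∂(∑ a ∈ Finset.range (n + 1),
    ENNReal.ofReal (x.1 n a) • Measure.dirac (vtxK hπ a)) = _
  rw [integral_finset_sum_measure]
  · refine Finset.sum_congr rfl fun a _ => ?_
    rw [integral_smul_measure, integral_dirac, ENNReal.toReal_ofReal (x.2.1.1 n a), smul_eq_mul]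
  · intro a _
    refine Integrable.smul_measure ?_ ENNReal.ofReal_ne_top
    exact integrable_dirac (by simp)

theorem integrable_of_cont {π : ℕ → ℕ → ℝ} (hπ : IsBalayage π) (m : Measure (Dpi π))
    [IsFiniteMeasure m] (g : Dpi π → ℝ) (hg : Continuous g) : Integrable g m := by
  haveI : CompactSpace (Dpi π) := isCompact_iff_compactSpace.mp (Dpi_isCompact hπ)
  exact (BoundedContinuousFunction.mkOfCompact ⟨g, hg⟩).integrable m

theorem cont_coord (π : ℕ → ℕ → ℝ) (k c : ℕ) : Continuous fun z : Dpi π => z.1 k c :=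
  (continuous_apply c).comp ((continuous_apply k).comp continuous_subtype_val)

theorem exists_lim {π : ℕ → ℕ → ℝ} (hπ : IsBalayage π) (x : Dpi π) (U : Ultrafilter ℕ)
    (hU : (U : Filter ℕ) ≤ atTop) :
    ∃ m : ProbabilityMeasure (Dpi π),
      (∀ g : Dpi π → ℝ, Continuous g →
        Tendsto (fun n => ∑ a ∈ Finset.range (n + 1), x.1 n a * g (vtxK hπ a)) U
          (𝓝 (∫ z, g z ∂(m : Measure (Dpi π))))) ∧
      ∀ k c, ∫ z : Dpi π, z.1 k c ∂(m : Measure (Dpi π)) = x.1 k c := by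
  haveI : CompactSpace (Dpi π) := isCompact_iff_compactSpace.mp (Dpi_isCompact hπ)
  obtain ⟨m, -, hm⟩ := isCompact_univ.ultrafilter_le_nhds (U.map (appr hπ x)) (by simp)
  have hm' : Tendsto (appr hπ x) U (𝓝 m) := hm
  rw [ProbabilityMeasure.tendsto_iff_forall_integral_tendsto] at hm'
  have key : ∀ g : Dpi π → ℝ, Continuous g →
        Tendsto (fun n => ∑ a ∈ Finset.range (n + 1), x.1 n a * g (vtxK hπ a)) U
          (𝓝 (∫ z, g z ∂(m : Measure (Dpi π)))) := by
    intro g hg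
    have := hm' (BoundedContinuousFunction.mkOfCompact ⟨g, hg⟩)
    simp only [BoundedContinuousFunction.mkOfCompact_apply, ContinuousMap.coe_mk] at this
    refine this.congr fun n => integral_appr hπ x n g hg
  refine ⟨m, key, fun k c => ?_⟩
  refine tendsto_nhds_unique (key _ (cont_coord π k c)) ?_
  refine tendsto_const_nhds.congr' ?_
  filter_upwards [hU (eventually_ge_atTop k)] with n hn
  exact (vtx_sum x.2 hn c).symm

theorem bary_mem {π : ℕ → ℕ → ℝ} (hπ : IsBalayage π) (m : Measure (Dpi π))
    [IsProbabilityMeasure m] (A : Set (Dpi π)) (hA : m.real A ≠ 0) :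
    (fun k c => (m.real A)⁻¹ * ∫ z in A, z.1 k c ∂m) ∈ Dpi π := by
  rw [mem_Dpi_iff hπ]
  have hi : ∀ k c, Integrable (fun z : Dpi π => z.1 k c) (m.restrict A) := fun k c =>
    integrable_of_cont hπ _ _ (cont_coord π k c)
  refine ⟨fun N a => ?_, fun N a h => ?_, fun N => ?_, fun N a h => ?_⟩
  · exact mul_nonneg (inv_nonneg.2 measureReal_nonneg)
      (integral_nonneg fun z => z.2.1.1 N a)
  · have : ∀ z : Dpi π, z.1 N a = 0 := fun z => z.2.1.2.1 N a h
    simp [this]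
  · rw [← Finset.mul_sum, ← integral_finset_sum _ fun a _ => hi N a]
    have : ∀ z : Dpi π, ∑ a ∈ Finset.range (N + 1), z.1 N a = 1 := fun z => z.2.1.2.2.1 N
    simp only [this]
    simp [hA]
  · have : ∀ z : Dpi π, z.1 N a = z.1 (N + 1) a + z.1 (N + 1) (N + 1) * π N a :=
      fun z => z.2.2 N a h
    simp only [this]
    rw [integral_add (hi _ _) ((hi _ _).mul_const _), integral_mul_const]
    ring

theorem ae_eq_of_ext {π : ℕ → ℕ → ℝ} (hπ : IsBalayage π) (y : Dpi π)
    (hy : y.1 ∈ Set.extremePoints ℝ (Dpi π)) (m : Measure (Dpi π))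
    [IsProbabilityMeasure m] (hm : ∀ k c, ∫ z : Dpi π, z.1 k c ∂m = y.1 k c) :
    ∀ᵐ z ∂m, z = y := by
  have key : ∀ k c, (fun z : Dpi π => z.1 k c) =ᵐ[m] fun _ => y.1 k c := by
    intro k c
    refine Integrable.ae_eq_of_forall_setIntegral_eq _ _
      (integrable_of_cont hπ _ _ (cont_coord π k c)) (integrable_const _) fun A hA _ => ?_
    rw [setIntegral_const, smul_eq_mul]
    by_cases h0 : m.real A = 0
    · rw [h0, zero_mul]
      rw [measureReal_eq_zero_iff] at h0
      rw [Measure.restrict_eq_zero.2 h0, integral_zero_measure]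
    have hcompl : m.real Aᶜ = 1 - m.real A := probReal_compl_eq_one_sub hA
    by_cases h1 : m.real Aᶜ = 0
    · have h2 : m.real A = 1 := by linarith
      rw [h2, one_mul, ← hm k c, ← integral_add_compl (μ := m) hA
        (integrable_of_cont hπ _ _ (cont_coord π k c))]
      rw [measureReal_eq_zero_iff] at h1
      rw [Measure.restrict_eq_zero.2 h1, integral_zero_measure, add_zero]
    have := hy.2 (bary_mem hπ m A h0) (bary_mem hπ m Aᶜ h1)
      ⟨m.real A, m.real Aᶜ, lt_of_le_of_ne measureReal_nonneg (Ne.symm h0),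
        lt_of_le_of_ne measureReal_nonneg (Ne.symm h1), by rw [hcompl]; ring, by
          funext k c
          simp only [Pi.add_apply, Pi.smul_apply, smul_eq_mul]
          rw [mul_inv_cancel_left₀ h0, mul_inv_cancel_left₀ h1, integral_add_compl hA
            (integrable_of_cont hπ _ _ (cont_coord π k c)), hm k c]⟩
    have h3 := congrFun (congrFun this k) c
    rw [← h3, mul_inv_cancel_left₀ h0]
  have h2 : ∀ᵐ z ∂m, ∀ k c, z.1 k c = y.1 k c := by
    rw [ae_all_iff]; intro k; rw [ae_all_iff]; intro c; exact key k c
  filter_upwards [h2] with z hz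
  exact Subtype.ext (funext fun k => funext fun c => hz k c)

theorem tendsto_ext {π : ℕ → ℕ → ℝ} (hπ : IsBalayage π) (y : Dpi π)
    (hy : y.1 ∈ Set.extremePoints ℝ (Dpi π)) (g : Dpi π → ℝ) (hg : Continuous g) :
    Tendsto (fun n => ∑ a ∈ Finset.range (n + 1), y.1 n a * g (vtxK hπ a)) atTop (𝓝 (g y)) := by
  rw [tendsto_iff_ultrafilter]
  intro U hU
  obtain ⟨m, h1, h2⟩ := exists_lim hπ y U hU
  have h3 := ae_eq_of_ext hπ y hy (m : Measure (Dpi π)) h2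
  have h4 : ∫ z, g z ∂(m : Measure (Dpi π)) = g y := by
    rw [integral_congr_ae (g := fun _ => g y)]
    · simp
    · filter_upwards [h3] with z hz
      rw [hz]
  rw [← h4]
  exact h1 g hg

/-- The measurable set of good points. -/
def good (π : ℕ → ℕ → ℝ) : Set (ℕ → ℕ → ℝ) :=
  {y | y ∈ Dpi π ∧ ∀ k c j : ℕ, ∃ n : ℕ, k ≤ n ∧
    ∑ a ∈ Finset.range (n + 1), y n a * (vtx π a k c) ^ 2 < (y k c) ^ 2 + 1 / ((j : ℝ) + 1)}

theorem good_meas {π : ℕ → ℕ → ℝ} (hπ : IsBalayage π) : MeasurableSet (good π) := by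
  have hc : ∀ N a, Measurable fun ν : ℕ → ℕ → ℝ => ν N a := fun N a => by fun_prop
  have : good π = Dpi π ∩ ⋂ k : ℕ, ⋂ c : ℕ, ⋂ j : ℕ, ⋃ n : ℕ, ⋃ _ : k ≤ n,
      {y | ∑ a ∈ Finset.range (n + 1), y n a * (vtx π a k c) ^ 2
        < (y k c) ^ 2 + 1 / ((j : ℝ) + 1)} := by
    ext y; simp [good]
  rw [this]
  refine (Dpi_isClosed hπ).measurableSet.inter ?_
  refine .iInter fun k => .iInter fun c => .iInter fun j => .iUnion fun n => .iUnion fun _ => ?_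
  refine measurableSet_lt ?_ (((hc k c).pow_const 2).add_const _)
  exact Finset.measurable_fun_sum _ fun a _ => (hc n a).mul_const _

theorem sq_le {π : ℕ → ℕ → ℝ} {y : ℕ → ℕ → ℝ} (hy : y ∈ Dpi π) {k n : ℕ} (hkn : k ≤ n)
    (c : ℕ) : (y k c) ^ 2 ≤ ∑ a ∈ Finset.range (n + 1), y n a * (vtx π a k c) ^ 2 := by
  have h0 : 0 ≤ ∑ a ∈ Finset.range (n + 1), y n a * (vtx π a k c - y k c) ^ 2 :=
    Finset.sum_nonneg fun a _ => mul_nonneg (hy.1.1 n a) (sq_nonneg _)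
  have h1 : ∑ a ∈ Finset.range (n + 1), y n a * (vtx π a k c - y k c) ^ 2 =
      ∑ a ∈ Finset.range (n + 1), y n a * (vtx π a k c) ^ 2
        - 2 * y k c * ∑ a ∈ Finset.range (n + 1), y n a * vtx π a k c
        + (y k c) ^ 2 * ∑ a ∈ Finset.range (n + 1), y n a := by
    rw [Finset.mul_sum, Finset.mul_sum, ← Finset.sum_sub_distrib, ← Finset.sum_add_distrib]
    exact Finset.sum_congr rfl fun a _ => by ring
  rw [vtx_sum hy hkn, hy.1.2.2.1 n] at h1
  nlinarith

theorem good_eq {π : ℕ → ℕ → ℝ} (hπ : IsBalayage π) :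
    good π = Set.extremePoints ℝ (Dpi π) := by
  ext y
  constructor
  · rintro ⟨hy, hg⟩
    refine ⟨hy, ?_⟩
    rintro u hu v hv ⟨s, t, hs, ht, hst, rfl⟩
    have key : ∀ k c, u k c = v k c := by
      intro k c
      have hle : ∀ j : ℕ, s * t * (u k c - v k c) ^ 2 ≤ 1 / ((j : ℝ) + 1) := by
        intro j
        obtain ⟨n, hn, h⟩ := hg k c j
        have h1 := sq_le hu hn c
        have h2 := sq_le hv hn c
        simp only [Pi.add_apply, Pi.smul_apply, smul_eq_mul, add_mul, mul_assoc,
          Finset.sum_add_distrib, ← Finset.mul_sum] at h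
        have h3 := mul_le_mul_of_nonneg_left h1 hs.le
        have h4 := mul_le_mul_of_nonneg_left h2 ht.le
        obtain rfl : t = 1 - s := by linarith
        nlinarith
      have h0 : s * t * (u k c - v k c) ^ 2 ≤ 0 :=
        ge_of_tendsto' tendsto_one_div_add_atTop_nhds_zero_nat hle
      have hst' : 0 < s * t := mul_pos hs ht
      have : (u k c - v k c) ^ 2 ≤ 0 := by
        by_contra hcon
        push Not at hcon
        have := mul_pos hst' hcon
        linarith
      have := pow_eq_zero_iff (two_ne_zero) |>.1 (le_antisymm this (sq_nonneg _))
      linarith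
    have huv : u = v := funext fun k => funext fun c => key k c
    subst huv
    rw [← add_smul, hst, one_smul]
  · intro hy
    refine ⟨hy.1, fun k c j => ?_⟩
    have h := tendsto_ext hπ ⟨y, hy.1⟩ hy (fun z => (z.1 k c) ^ 2) ((cont_coord π k c).pow 2)
    have h0 : 0 < 1 / ((j : ℝ) + 1) := by positivity
    have h1 : (y k c) ^ 2 < (y k c) ^ 2 + 1 / ((j : ℝ) + 1) := by linarith
    have h' := h.eventually_lt_const h1
    obtain ⟨n, hn1, hn2⟩ := (h'.and (eventually_ge_atTop k)).exists
    exact ⟨n, hn2, hn1⟩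

theorem affine_sum {E : Type*} [AddCommGroup E] [Module ℝ E] {K : Set E} (hK : Convex ℝ K)
    {f : E → ℝ} (hf : AffineOn f K) {ι : Type*} (s : Finset ι) (w : ι → ℝ) (p : ι → E)
    (hw : ∀ i ∈ s, 0 ≤ w i) (h1 : ∑ i ∈ s, w i = 1) (hp : ∀ i ∈ s, p i ∈ K) :
    f (∑ i ∈ s, w i • p i) = ∑ i ∈ s, w i * f (p i) := by
  have hc : ConvexOn ℝ K f := ⟨hK, fun x hx y hy a b ha hb hab => by
    obtain rfl : b = 1 - a := by linarith
    rw [hf x hx y hy a ha (by linarith)]; simp⟩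
  have hc' : ConcaveOn ℝ K f := ⟨hK, fun x hx y hy a b ha hb hab => by
    obtain rfl : b = 1 - a := by linarith
    rw [hf x hx y hy a ha (by linarith)]; simp⟩
  have e1 := hc.map_sum_le hw h1 hp
  have e2 := hc'.le_map_sum hw h1 hp
  simp only [smul_eq_mul] at e1 e2
  exact le_antisymm e1 e2

theorem represents {π : ℕ → ℕ → ℝ} (hπ : IsBalayage π) (x : Dpi π) (U : Ultrafilter ℕ)
    (hU : (U : Filter ℕ) ≤ atTop) (m : Measure (Dpi π))
    (h : ∀ g : Dpi π → ℝ, Continuous g →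
        Tendsto (fun n => ∑ a ∈ Finset.range (n + 1), x.1 n a * g (vtxK hπ a)) U
          (𝓝 (∫ z, g z ∂m))) :
    RepresentsOn (m.map Subtype.val) (Dpi π) x.1 := by
  intro f hf hfa
  have hme : MeasurableEmbedding (Subtype.val : Dpi π → ℕ → ℕ → ℝ) :=
    MeasurableEmbedding.subtype_coe (Dpi_isClosed hπ).measurableSet
  rw [hme.integral_map]
  have hg : Continuous fun z : Dpi π => f z.1 := continuousOn_iff_continuous_restrict.1 hf
  refine tendsto_nhds_unique ?_ (h _ hg)
  have hb : ∀ n, ∑ a ∈ Finset.range (n + 1), x.1 n a • vtx π a ∈ Dpi π := fun n =>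
    (Dpi_convex hπ).sum_mem (fun a _ => x.2.1.1 n a) (x.2.1.2.2.1 n) fun a _ => vtx_mem hπ a
  have heq : ∀ n, ∑ a ∈ Finset.range (n + 1), x.1 n a * f (vtxK hπ a).1 =
      f (∑ a ∈ Finset.range (n + 1), x.1 n a • vtx π a) := fun n =>
    (affine_sum (Dpi_convex hπ) hfa _ _ _ (fun a _ => x.2.1.1 n a) (x.2.1.2.2.1 n)
      fun a _ => vtx_mem hπ a).symm
  simp only [heq]
  have hlim : Tendsto (fun n => (⟨_, hb n⟩ : Dpi π)) atTop (𝓝 x) := by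
    rw [tendsto_subtype_rng, tendsto_pi_nhds]
    intro k
    rw [tendsto_pi_nhds]
    intro c
    refine tendsto_const_nhds.congr' ?_
    filter_upwards [eventually_ge_atTop k] with n hn
    rw [← vtx_sum x.2 hn c]
    simp [Finset.sum_apply]
  exact ((hg.tendsto x).comp hlim).mono_left hU

theorem supp_good {π : ℕ → ℕ → ℝ} (hπ : IsBalayage π) (x : Dpi π) (U : Ultrafilter ℕ)
    (hU : (U : Filter ℕ) ≤ atTop) (m : Measure (Dpi π)) [IsProbabilityMeasure m]
    (h : ∀ g : Dpi π → ℝ, Continuous g →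
        Tendsto (fun n => ∑ a ∈ Finset.range (n + 1), x.1 n a * g (vtxK hπ a)) U
          (𝓝 (∫ z, g z ∂m)))
    (hm : ∀ k c, ∫ z : Dpi π, z.1 k c ∂m = x.1 k c) :
    ∀ᵐ z ∂m, z.1 ∈ good π := by
  have key : ∀ k c j : ℕ, ∀ᵐ z : Dpi π ∂m, ∃ n : ℕ, k ≤ n ∧
    ∑ a ∈ Finset.range (n + 1), z.1 n a * (vtx π a k c) ^ 2
      < (z.1 k c) ^ 2 + 1 / ((j : ℝ) + 1) := by
    intro k c j
    have hε : 0 < 1 / ((j : ℝ) + 1) := by positivity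
    set ε := 1 / ((j : ℝ) + 1)
    rw [ae_iff]
    push Not
    set B := {z : Dpi π | ∀ n : ℕ, k ≤ n →
      (z.1 k c) ^ 2 + ε ≤ ∑ a ∈ Finset.range (n + 1), z.1 n a * (vtx π a k c) ^ 2}
    have hsq : Continuous fun z : Dpi π => (z.1 k c) ^ 2 := (cont_coord π k c).pow 2
    have hF : ∀ n, Continuous fun z : Dpi π =>
        ∑ a ∈ Finset.range (n + 1), z.1 n a * (vtx π a k c) ^ 2 := fun n =>
      continuous_finset_sum _ fun a _ => (cont_coord π n a).mul continuous_const
    have hFi : ∀ n, ∫ z : Dpi π, ∑ a ∈ Finset.range (n + 1), z.1 n a * (vtx π a k c) ^ 2 ∂m =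
        ∑ a ∈ Finset.range (n + 1), x.1 n a * (vtx π a k c) ^ 2 := by
      intro n
      rw [integral_finset_sum _ fun a _ =>
        (integrable_of_cont hπ m _ (cont_coord π n a)).mul_const _]
      refine Finset.sum_congr rfl fun a _ => ?_
      rw [integral_mul_const, hm]
    have hbd : ∀ n, k ≤ n → ε * m.real B ≤
        ∑ a ∈ Finset.range (n + 1), x.1 n a * (vtx π a k c) ^ 2
          - ∫ z : Dpi π, (z.1 k c) ^ 2 ∂m := by
      intro n hn
      rw [← hFi n, ← integral_sub (integrable_of_cont hπ m _ (hF n))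
        (integrable_of_cont hπ m _ hsq)]
      refine le_trans ?_ (mul_meas_ge_le_integral_of_nonneg (ε := ε) ?_ ?_)
      · refine mul_le_mul_of_nonneg_left ?_ hε.le
        refine measureReal_mono fun z hz => ?_
        have := hz n hn
        simp only [Set.mem_setOf_eq]
        linarith
      · exact Eventually.of_forall fun z => sub_nonneg.2 (sq_le z.2 hn c)
      · exact (integrable_of_cont hπ m _ (hF n)).sub (integrable_of_cont hπ m _ hsq)
    have hlim := (h _ hsq).sub_const (∫ z : Dpi π, (z.1 k c) ^ 2 ∂m)
    rw [sub_self] at hlim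
    have hle : ε * m.real B ≤ 0 := by
      refine ge_of_tendsto hlim ?_
      filter_upwards [hU (eventually_ge_atTop k)] with n hn
      exact hbd n hn
    have : m.real B = 0 := by
      refine le_antisymm ?_ measureReal_nonneg
      by_contra hcon
      push Not at hcon
      have := mul_pos hε hcon
      linarith
    exact (measureReal_eq_zero_iff).1 this
  have h2 : ∀ᵐ z : Dpi π ∂m, ∀ k c j : ℕ, ∃ n : ℕ, k ≤ n ∧
    ∑ a ∈ Finset.range (n + 1), z.1 n a * (vtx π a k c) ^ 2
      < (z.1 k c) ^ 2 + 1 / ((j : ℝ) + 1) := by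
    simp only [ae_all_iff]
    exact key
  filter_upwards [h2] with z hz
  exact ⟨z.2, hz⟩

theorem integral_eq_lim {π : ℕ → ℕ → ℝ} (hπ : IsBalayage π) (x : ℕ → ℕ → ℝ)
    (m : Measure (ℕ → ℕ → ℝ)) [IsProbabilityMeasure m]
    (h1 : m (Set.extremePoints ℝ (Dpi π)) = 1) (h2 : RepresentsOn m (Dpi π) x)
    (g : BoundedContinuousFunction (ℕ → ℕ → ℝ) ℝ) :
    Tendsto (fun n => ∑ a ∈ Finset.range (n + 1), x n a * g (vtx π a)) atTop
      (𝓝 (∫ z, g z ∂m)) := by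
  have hext : ∀ᵐ y ∂m, y ∈ Set.extremePoints ℝ (Dpi π) := by
    rw [← good_eq hπ] at h1 ⊢
    exact (prob_compl_eq_zero_iff (good_meas hπ)).2 h1
  have hcm : ∀ N a, Measurable fun ν : ℕ → ℕ → ℝ => ν N a := fun N a => by fun_prop
  have hint : ∀ k c, Integrable (fun z : ℕ → ℕ → ℝ => z k c) m := by
    intro k c
    refine Integrable.of_bound (hcm k c).aestronglyMeasurable 1 ?_
    filter_upwards [hext] with z hz
    rw [Real.norm_eq_abs, abs_of_nonneg (hz.1.1.1 k c)]
    exact Dpi_le_one hz.1 k c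
  have hx : ∀ k c, x k c = ∫ z, z k c ∂m := fun k c =>
    h2 (fun z => z k c) (by fun_prop) (fun u _ v _ t _ _ => by simp)
  have heq : ∀ n, ∑ a ∈ Finset.range (n + 1), x n a * g (vtx π a) =
      ∫ z, ∑ a ∈ Finset.range (n + 1), z n a * g (vtx π a) ∂m := by
    intro n
    rw [integral_finset_sum _ fun a _ => (hint n a).mul_const _]
    refine Finset.sum_congr rfl fun a _ => ?_
    rw [integral_mul_const, hx]
  simp only [heq]
  refine tendsto_integral_of_dominated_convergence (fun _ => ‖g‖) ?_ (integrable_const _) ?_ ?_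
  · intro n
    exact (Finset.measurable_fun_sum _ fun a _ => (hcm n a).mul_const _).aestronglyMeasurable
  · intro n
    filter_upwards [hext] with z hz
    calc ‖∑ a ∈ Finset.range (n + 1), z n a * g (vtx π a)‖
        ≤ ∑ a ∈ Finset.range (n + 1), z n a * ‖g‖ := by
          refine norm_sum_le_of_le _ fun a _ => ?_
          rw [norm_mul, Real.norm_eq_abs, abs_of_nonneg (hz.1.1.1 n a)]
          exact mul_le_mul_of_nonneg_left (g.norm_coe_le_norm _) (hz.1.1.1 n a)
      _ = ‖g‖ := by rw [← Finset.sum_mul, hz.1.1.2.2.1 n, one_mul]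
  · filter_upwards [hext] with z hz
    exact tendsto_ext hπ ⟨z, hz.1⟩ hz (fun w => g w.1) (g.continuous.comp continuous_subtype_val)

end Helpers

/-- for every balayage `π`, the compact convex set `𝒟(π)` is a Choquet simplex. -/
theorem statement6 (π : ℕ → ℕ → ℝ) (hπ : IsBalayage π) :
    IsChoquetSimplex (Dpi π) := by
  intro x hx
  have hme : MeasurableEmbedding (Subtype.val : Dpi π → ℕ → ℕ → ℝ) :=
    MeasurableEmbedding.subtype_coe (Dpi_isClosed hπ).measurableSet
  refine existsUnique_of_exists_of_unique ?_ ?_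
  · obtain ⟨m, h1, h2⟩ := exists_lim hπ ⟨x, hx⟩ (Ultrafilter.of atTop) (Ultrafilter.of_le _)
    have hp : IsProbabilityMeasure ((m : Measure (Dpi π)).map Subtype.val) :=
      Measure.isProbabilityMeasure_map hme.measurable.aemeasurable
    refine ⟨(m : Measure (Dpi π)).map Subtype.val, hp, ?_,
      represents hπ ⟨x, hx⟩ _ (Ultrafilter.of_le _) m h1⟩
    rw [← good_eq hπ, ← prob_compl_eq_zero_iff (good_meas hπ), hme.map_apply]
    exact supp_good hπ ⟨x, hx⟩ _ (Ultrafilter.of_le _) m h1 h2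
  · rintro m₁ m₂ ⟨p1, e1, r1⟩ ⟨p2, e2, r2⟩
    refine ext_of_forall_integral_eq_of_IsFiniteMeasure fun g => ?_
    exact tendsto_nhds_unique (integral_eq_lim hπ x m₁ e1 r1 g) (integral_eq_lim hπ x m₂ e2 r2 g)

end VMCPaper
end

section
/- Let π be the balayage with π_N = δ_N for every N ∈ ℕ. For a ∈ ℕ let ν^a := {δ_{min(N,a)}}_{N∈ℕ} and let ν^∞ := {δ_N}_{N∈ℕ}. Then ν^a → ν^∞ in 𝒟 as a → ∞, and the set of extreme points of 𝒟(π) is exactly {ν^a : a ∈ ℕ} ∪ {ν^∞}; in particular ext(𝒟(π)) is compact. -/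
open MeasureTheory Filter
open scoped ENNReal NNReal

namespace VMCPaper

/-- the balayage `π_N = δ_N` -/
noncomputable def pi7 : ℕ → ℕ → ℝ := fun N b => if b = N then 1 else 0

/-- `ν^a = {δ_{min(N,a)}}_N` -/
noncomputable def nu7 (a : ℕ) : ℕ → ℕ → ℝ := fun N b => if b = min N a then 1 else 0

/-- `ν^∞ = {δ_N}_N` -/
noncomputable def nu7inf : ℕ → ℕ → ℝ := fun N b => if b = N then 1 else 0

noncomputable def GG (t : ℕ → ℝ) : ℕ → ℕ → ℝ := fun N a =>
  if a < N then t a - t (a + 1) else if a = N then t N else 0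

lemma GG_mem (t : ℕ → ℝ) (h0 : t 0 = 1) (hn : ∀ n, 0 ≤ t n) (hd : ∀ n, t (n + 1) ≤ t n) :
    GG t ∈ Dpi pi7 := by
  have hnon : ∀ N a, 0 ≤ GG t N a := by
    intro N a
    unfold GG
    split_ifs
    · linarith [hd a]
    · exact hn N
    · exact le_rfl
  have hbal : ∀ N a, a ≤ N → GG t N a = GG t (N + 1) a + GG t (N + 1) (N + 1) * pi7 N a := by
    intro N a ha
    unfold GG pi7
    rcases ha.lt_or_eq with h | h
    · simp [h, h.ne, Nat.lt_succ_of_lt h]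
    · subst h
      simp
  refine ⟨⟨hnon, ?_, ?_, ?_⟩, hbal⟩
  · intro N a h
    unfold GG
    rw [if_neg (by omega), if_neg (by omega)]
  · intro N
    rw [Finset.sum_range_succ]
    have : ∑ a ∈ Finset.range N, GG t N a = ∑ a ∈ Finset.range N, (t a - t (a + 1)) := by
      refine Finset.sum_congr rfl fun a ha => ?_
      unfold GG
      rw [if_pos (Finset.mem_range.1 ha)]
    rw [this, Finset.sum_range_sub']
    simp [GG, h0]
  · intro N a ha
    rw [hbal N a ha]
    have : 0 ≤ pi7 N a := by unfold pi7; split_ifs <;> norm_num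
    have := mul_nonneg (hnon (N + 1) (N + 1)) this
    linarith

lemma diag_step {ν : ℕ → ℕ → ℝ} (h : ν ∈ Dpi pi7) (N : ℕ) :
    ν N N = ν (N + 1) N + ν (N + 1) (N + 1) := by
  have := h.2 N N le_rfl
  simpa [pi7] using this

lemma eq_GG {ν : ℕ → ℕ → ℝ} (h : ν ∈ Dpi pi7) : ν = GG (fun n => ν n n) := by
  funext N a
  unfold GG
  split_ifs with h1 h2
  · induction N, h1 using Nat.le_induction with
    | base => have := diag_step h a; linarith
    | succ n hn ih =>
      have h3 := h.2 n a (by omega)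
      have : pi7 n a = 0 := by unfold pi7; rw [if_neg (by omega)]
      rw [this] at h3
      linarith
  · rw [h2]
  · exact h.1.2.1 N a (by omega)

lemma diag_zero {ν : ℕ → ℕ → ℝ} (h : ν ∈ Dpi pi7) : ν 0 0 = 1 := by
  simpa using h.1.2.2.1 0

lemma diag_anti {ν : ℕ → ℕ → ℝ} (h : ν ∈ Dpi pi7) : Antitone (fun n => ν n n) :=
  antitone_nat_of_succ_le fun n => by
    have := diag_step h n
    have := h.1.1 (n + 1) n
    linarith

lemma le_one {ν : ℕ → ℕ → ℝ} (h : ν ∈ Dpi pi7) (N a : ℕ) : ν N a ≤ 1 := by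
  by_cases ha : a ≤ N
  · rw [← h.1.2.2.1 N]
    exact Finset.single_le_sum (f := ν N) (fun i _ => h.1.1 N i)
      (Finset.mem_range.2 (by omega))
  · rw [h.1.2.1 N a (by omega)]
    norm_num

lemma extreme_of_01 {ν : ℕ → ℕ → ℝ} (h : ν ∈ Dpi pi7) (h01 : ∀ N a, ν N a = 0 ∨ ν N a = 1) :
    ν ∈ Set.extremePoints ℝ (Dpi pi7) := by
  rw [mem_extremePoints_iff_left]
  refine ⟨h, fun x hx y hy hxy => ?_⟩
  obtain ⟨p, q, hp, hq, hpq, he⟩ := hxy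
  funext N a
  have e : p * x N a + q * y N a = ν N a := by rw [← he]; rfl
  have x0 := hx.1.1 N a
  have y0 := hy.1.1 N a
  have x1 := le_one hx N a
  have y1 := le_one hy N a
  rcases h01 N a with h | h
  · rw [h] at e ⊢
    nlinarith [mul_nonneg hp.le x0, mul_nonneg hq.le y0]
  · rw [h] at e ⊢
    nlinarith [mul_nonneg hp.le (sub_nonneg.2 x1), mul_nonneg hq.le (sub_nonneg.2 y1)]

lemma diag_01 {ν : ℕ → ℕ → ℝ} (h : ν ∈ Set.extremePoints ℝ (Dpi pi7)) (M : ℕ) :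
    ν M M = 0 ∨ ν M M = 1 := by
  rw [mem_extremePoints_iff_left] at h
  obtain ⟨h, hext⟩ := h
  by_contra hc
  push Not at hc
  have hs0 : 0 < ν M M := lt_of_le_of_ne (h.1.1 M M) (Ne.symm hc.1)
  have hs1 : ν M M < 1 := lt_of_le_of_ne (le_one h M M) hc.2
  have hanti := diag_anti h
  set t : ℕ → ℝ := fun n => ν n n with ht
  have htM : ν M M = t M := rfl
  have hν : ν = GG t := eq_GG h
  have ht0 : t 0 = 1 := diag_zero h
  have htn : ∀ n, 0 ≤ t n := fun n => h.1.1 n n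
  rw [htM] at hs0 hs1 hc
  have hs1' : 0 < 1 - t M := by linarith
  let x : ℕ → ℝ := fun n => if n ≤ M then 1 else t n / t M
  let y : ℕ → ℝ := fun n => if n ≤ M then (t n - t M) / (1 - t M) else 0
  have hx : GG x ∈ Dpi pi7 := by
    refine GG_mem x (by simp [x]) (fun n => ?_) (fun n => ?_)
    · simp only [x]
      split_ifs
      · norm_num
      · exact div_nonneg (htn n) hs0.le
    · simp only [x]
      split_ifs with h1 h2 h2
      · exact le_rfl
      · omega
      · rw [div_le_one hs0]
        exact hanti (by omega)
      · exact div_le_div_of_nonneg_right (hanti (by omega)) hs0.le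
  have hy : GG y ∈ Dpi pi7 := by
    refine GG_mem y (by simp [y, ht0, hs1'.ne']) (fun n => ?_) (fun n => ?_)
    · simp only [y]
      split_ifs with h1
      · exact div_nonneg (sub_nonneg.2 (hanti h1)) hs1'.le
      · exact le_rfl
    · simp only [y]
      split_ifs with h1 h2 h2
      · exact div_le_div_of_nonneg_right (by linarith [hanti (Nat.le_succ n)]) hs1'.le
      · omega
      · exact div_nonneg (sub_nonneg.2 (hanti h2)) hs1'.le
      · exact le_rfl
  have hxy : ∀ n, t M * x n + (1 - t M) * y n = t n := by
    intro n
    simp only [x, y]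
    split_ifs
    · field_simp
      ring
    · field_simp
      ring
  have key := hext (GG x) hx (GG y) hy ⟨t M, 1 - t M, hs0, hs1', by ring, by
    rw [hν]
    funext N a
    change t M * GG x N a + (1 - t M) * GG y N a = GG t N a
    unfold GG
    split_ifs
    · linarith [hxy a, hxy (a + 1)]
    · exact hxy N
    · ring⟩
  have := congrFun (congrFun key M) M
  rw [htM] at this
  simp [GG, x] at this
  exact hc.2 this.symm

lemma nu7_eq (a : ℕ) : nu7 a = GG (fun n => if n ≤ a then 1 else 0) := by
  funext N b
  unfold nu7 GG
  beta_reduce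
  rcases le_total N a with h | h
  · rw [min_eq_left h]
    split_ifs <;> first | omega | (norm_num; done)
  · rw [min_eq_right h]
    split_ifs <;> first | omega | (norm_num; done)

lemma nu7inf_eq : nu7inf = GG (fun _ => 1) := by
  funext N b
  unfold nu7inf GG
  split_ifs <;> first | omega | norm_num

lemma nu7_tendsto : Tendsto nu7 atTop (nhds nu7inf) := by
  rw [tendsto_pi_nhds]
  intro N
  rw [tendsto_pi_nhds]
  intro b
  refine tendsto_const_nhds.congr' ?_
  filter_upwards [eventually_ge_atTop N] with a ha
  simp [nu7, nu7inf, min_eq_left ha]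

lemma ext_eq : Set.extremePoints ℝ (Dpi pi7) = Set.range nu7 ∪ {nu7inf} := by
  ext ν
  constructor
  · intro h
    have h01 := diag_01 h
    have hm : ν ∈ Dpi pi7 := h.1
    have hν := eq_GG hm
    have hanti := diag_anti hm
    by_cases hall : ∀ n, ν n n = 1
    · right
      rw [Set.mem_singleton_iff, nu7inf_eq, hν]
      congr 1
      funext n
      exact hall n
    · left
      push Not at hall
      classical
      have hf := Nat.find_spec hall
      have hmin : ∀ m < Nat.find hall, ν m m = 1 := fun m hm' => by
        simpa using Nat.find_min hall hm'
      obtain ⟨k, hk⟩ : ∃ k, Nat.find hall = k + 1 := by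
        refine Nat.exists_eq_succ_of_ne_zero fun h0 => ?_
        rw [h0] at hf
        exact hf (diag_zero hm)
      rw [hk] at hf hmin
      refine ⟨k, ?_⟩
      rw [nu7_eq, hν]
      congr 1
      funext n
      split_ifs with hn
      · exact (hmin n (by omega)).symm
      · have h1 : ν (k + 1) (k + 1) = 0 := (h01 (k + 1)).resolve_right hf
        have h2 : ν n n ≤ ν (k + 1) (k + 1) := hanti (by omega : k + 1 ≤ n)
        have h3 := hm.1.1 n n
        linarith
  · rintro (⟨a, rfl⟩ | h)
    · refine extreme_of_01 ?_ ?_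
      · rw [nu7_eq]
        refine GG_mem _ (by simp) (fun n => ?_) (fun n => ?_)
        · split_ifs <;> norm_num
        · split_ifs <;> first | omega | norm_num
      · intro N b
        unfold nu7
        split_ifs <;> simp
    · rw [Set.mem_singleton_iff] at h
      subst h
      refine extreme_of_01 ?_ ?_
      · rw [nu7inf_eq]
        exact GG_mem _ rfl (fun n => zero_le_one) (fun n => le_rfl)
      · intro N b
        unfold nu7inf
        split_ifs <;> simp

/-- for the balayage `π_N = δ_N`, one has `ν^a → ν^∞`, and the extreme points of
`𝒟(π)` are exactly `{ν^a : a ∈ ℕ} ∪ {ν^∞}`; in particular the set of extreme points is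
compact. -/
theorem statement7 :
    Tendsto nu7 atTop (nhds nu7inf) ∧
    Set.extremePoints ℝ (Dpi pi7) = Set.range nu7 ∪ {nu7inf} ∧
    IsCompact (Set.extremePoints ℝ (Dpi pi7)) := by
  refine ⟨nu7_tendsto, ext_eq, ?_⟩
  rw [ext_eq, Set.union_singleton]
  exact nu7_tendsto.isCompact_insert_range

end VMCPaper
end

section
/- Let π be the balayage with π_0 = δ_0 and π_N = δ_{N−1} for N ≥ 1. For a ∈ ℕ let ν^a := {ν^a_N}_{N∈ℕ} with ν^a_0 = δ_0, ν^a_N = δ_{a − 2⌈(a−N)/2⌉} for 0 < N < a, and ν^a_N = δ_a for N ≥ a. Let ν^even := {δ_{2⌊N/2⌋}}_{N∈ℕ}, and let ν^odd := {ν_N}_{N∈ℕ} with ν_0 = δ_0 and ν_N = δ_{2⌈N/2⌉−1} for N ≥ 1. Then ν^{2a} → ν^even and ν^{2a+1} → ν^odd in 𝒟 as a → ∞, and the set of extreme points of 𝒟(π) is exactly {ν^a : a ∈ ℕ} ∪ {ν^even, ν^odd}. -/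
open MeasureTheory Filter
open scoped ENNReal NNReal

namespace VMCPaper

/-- the balayage with `π_0 = δ_0` and `π_N = δ_{N-1}` for `N ≥ 1` -/
noncomputable def pi8 : ℕ → ℕ → ℝ := fun N b =>
  if N = 0 then (if b = 0 then 1 else 0) else (if b = N - 1 then 1 else 0)

/-- `ν^a` with `ν^a_0 = δ_0`, `ν^a_N = δ_{a - 2⌈(a-N)/2⌉}` for `0 < N < a`, and
`ν^a_N = δ_a` for `N ≥ a` (note `⌈(a-N)/2⌉ = (a - N + 1) / 2` in ℕ for `N < a`). -/
noncomputable def nu8 (a : ℕ) : ℕ → ℕ → ℝ := fun N b =>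
  if N = 0 then (if b = 0 then 1 else 0)
  else if N < a then (if b = a - 2 * ((a - N + 1) / 2) then 1 else 0)
  else (if b = a then 1 else 0)

/-- `ν^even = {δ_{2⌊N/2⌋}}_N` -/
noncomputable def nu8even : ℕ → ℕ → ℝ := fun N b => if b = 2 * (N / 2) then 1 else 0

/-- `ν^odd` with `ν_0 = δ_0` and `ν_N = δ_{2⌈N/2⌉ - 1}` for `N ≥ 1` -/
noncomputable def nu8odd : ℕ → ℕ → ℝ := fun N b =>
  if N = 0 then (if b = 0 then 1 else 0)
  else (if b = 2 * ((N + 1) / 2) - 1 then 1 else 0)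

lemma pi8_eq (N b : ℕ) : pi8 N b = if b = N - 1 then 1 else 0 := by
  unfold pi8
  rcases Nat.eq_zero_or_pos N with h | h
  · subst h; simp
  · rw [if_neg (by omega)]

lemma pi8_nonneg (N b : ℕ) : 0 ≤ pi8 N b := by
  rw [pi8_eq]; split_ifs <;> norm_num

noncomputable def dl (s : ℕ → ℕ) : ℕ → ℕ → ℝ := fun N b => if b = s N then 1 else 0

def Good (s : ℕ → ℕ) : Prop :=
  (∀ N, s N ≤ N) ∧ ∀ N, (s (N + 1) = N + 1 ∧ s N = N - 1) ∨ (s (N + 1) ≤ N ∧ s N = s (N + 1))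

lemma dl_mem {s : ℕ → ℕ} (hs : Good s) : dl s ∈ Dpi pi8 := by
  have heq : ∀ N a, a ≤ N →
      dl s N a = dl s (N + 1) a + dl s (N + 1) (N + 1) * pi8 N a := by
    intro N a ha
    rw [pi8_eq]
    unfold dl
    rcases hs.2 N with ⟨h1, h2⟩ | ⟨h1, h2⟩
    · rw [h1, h2, if_neg (show a ≠ N + 1 by omega)]; simp
    · rw [h2, if_neg (show N + 1 ≠ s (N + 1) by omega)]; simp
  have hnn : ∀ N a, 0 ≤ dl s N a := by
    intro N a; unfold dl; split_ifs <;> norm_num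
  refine ⟨⟨hnn, ?_, ?_, ?_⟩, heq⟩
  · intro N a h
    have := hs.1 N
    unfold dl
    rw [if_neg (by omega)]
  · intro N
    have := hs.1 N
    unfold dl
    rw [Finset.sum_ite_eq']
    simp; omega
  · intro N a ha
    rw [heq N a ha]
    have := mul_nonneg (hnn (N + 1) (N + 1)) (pi8_nonneg N a)
    linarith

lemma dpi_le_one {ν : ℕ → ℕ → ℝ} (h : ν ∈ Dpi pi8) (N a : ℕ) : ν N a ≤ 1 := by
  obtain ⟨⟨h0, h1, h2, h3⟩, h4⟩ := h
  by_cases ha : a ≤ N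
  · rw [← h2 N]
    exact Finset.single_le_sum (f := ν N) (fun i _ => h0 N i) (by simp; omega)
  · rw [h1 N a (by omega)]; norm_num

lemma dl_extreme {s : ℕ → ℕ} (hs : Good s) : dl s ∈ Set.extremePoints ℝ (Dpi pi8) := by
  rw [mem_extremePoints]
  refine ⟨dl_mem hs, ?_⟩
  rintro x hx y hy ⟨p, q, hp, hq, hpq, he⟩
  have key : ∀ N b, x N b = dl s N b ∧ y N b = dl s N b := by
    intro N b
    have e : p * x N b + q * y N b = dl s N b := by rw [← he]; simp
    have hx0 := hx.1.1 N b
    have hy0 := hy.1.1 N b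
    have hx1 := dpi_le_one hx N b
    have hy1 := dpi_le_one hy N b
    unfold dl at e ⊢
    split_ifs at e ⊢
    · constructor
      · by_contra hne
        have : x N b < 1 := lt_of_le_of_ne hx1 hne
        nlinarith
      · by_contra hne
        have : y N b < 1 := lt_of_le_of_ne hy1 hne
        nlinarith
    · constructor
      · by_contra hne
        have : 0 < x N b := lt_of_le_of_ne hx0 (Ne.symm hne)
        nlinarith [mul_pos hp this, mul_nonneg hq.le hy0]
      · by_contra hne
        have : 0 < y N b := lt_of_le_of_ne hy0 (Ne.symm hne)
        nlinarith [mul_pos hq this, mul_nonneg hp.le hx0]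
  exact ⟨funext fun N => funext fun b => (key N b).1, funext fun N => funext fun b => (key N b).2⟩

lemma path_antitone {s : ℕ → ℕ} (hs : Good s) {ν : ℕ → ℕ → ℝ} (h : ν ∈ Dpi pi8) :
    Antitone (fun N => ν N (s N)) := by
  apply antitone_nat_of_succ_le
  intro N
  have h4 := h.2 N (s N) (hs.1 N)
  have h0 := h.1.1 (N + 1)
  rw [pi8_eq] at h4
  rcases hs.2 N with ⟨h1, h2⟩ | ⟨h1, h2⟩
  · rw [if_pos h2] at h4
    have := h0 (s N)
    rw [h1]; linarith
  · rw [h4]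
    have := h0 (N + 1)
    rw [← h2]
    split_ifs <;> linarith

lemma eq_dl {s : ℕ → ℕ} (hs : Good s) {ν : ℕ → ℕ → ℝ}
    (h : ν ∈ Set.extremePoints ℝ (Dpi pi8)) {t : ℝ} (ht : 0 < t)
    (hb : ∀ N, t ≤ ν N (s N)) : ν = dl s := by
  rw [mem_extremePoints] at h
  obtain ⟨hm, hext⟩ := h
  have hd := dl_mem hs
  have ht1 : t ≤ 1 := (hb 0).trans (dpi_le_one hm _ _)
  set u : ℝ := t / 2 with hu
  have hu0 : 0 < u := by positivity
  have hu1 : 0 < 1 - u := by linarith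
  have heq : ∀ N a, a ≤ N → (1 - u)⁻¹ * (ν N a - u * dl s N a) =
      (1 - u)⁻¹ * (ν (N + 1) a - u * dl s (N + 1) a) +
      (1 - u)⁻¹ * (ν (N + 1) (N + 1) - u * dl s (N + 1) (N + 1)) * pi8 N a := by
    intro N a ha
    rw [hm.2 N a ha, hd.2 N a ha]; ring
  have hnn : ∀ N a, 0 ≤ (1 - u)⁻¹ * (ν N a - u * dl s N a) := by
    intro N a
    apply mul_nonneg (by positivity)
    unfold dl
    split_ifs with hc
    · have := hb N
      rw [← hc] at this; linarith
    · have := hm.1.1 N a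
      linarith
  have hν' : (fun N a => (1 - u)⁻¹ * (ν N a - u * dl s N a)) ∈ Dpi pi8 := by
    refine ⟨⟨hnn, ?_, ?_, ?_⟩, heq⟩
    · intro N a ha
      simp only [hm.1.2.1 N a ha, hd.1.2.1 N a ha]; ring
    · intro N
      simp only
      rw [← Finset.mul_sum, Finset.sum_sub_distrib, ← Finset.mul_sum, hm.1.2.2.1, hd.1.2.2.1]
      field_simp
    · intro N a ha
      have := mul_nonneg (hnn (N + 1) (N + 1)) (pi8_nonneg N a)
      have e := heq N a ha
      simp only
      linarith
  have := hext _ hd _ hν' ⟨u, 1 - u, hu0, hu1, by ring, ?_⟩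
  · exact this.1.symm
  · funext N a
    simp only [Pi.add_apply, Pi.smul_apply, smul_eq_mul]
    field_simp
    ring

def sa (a N : ℕ) : ℕ :=
  if N = 0 then 0 else if N < a then a - 2 * ((a - N + 1) / 2) else a
def se (N : ℕ) : ℕ := 2 * (N / 2)
def so (N : ℕ) : ℕ := 2 * ((N + 1) / 2) - 1

lemma nu8_eq (a : ℕ) : nu8 a = dl (sa a) := by
  funext N b; unfold nu8 dl sa; split_ifs <;> rfl
lemma nu8even_eq : nu8even = dl se := rfl
lemma nu8odd_eq : nu8odd = dl so := by
  funext N b; unfold nu8odd dl so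
  rcases Nat.eq_zero_or_pos N with h | h
  · subst h; simp
  · rw [if_neg (by omega)]

lemma good_sa (a : ℕ) : Good (sa a) := by
  constructor
  · intro N; unfold sa; split_ifs <;> omega
  · intro N
    have e1 : sa a (N + 1) = if N + 1 < a then a - 2 * ((a - (N + 1) + 1) / 2) else a := by
      unfold sa; rw [if_neg (by omega)]
    rw [e1]
    by_cases h0 : N = 0
    · have e0 : sa a N = 0 := by unfold sa; rw [if_pos h0]
      rw [e0]; split_ifs <;> omega
    · have e0 : sa a N = if N < a then a - 2 * ((a - N + 1) / 2) else a := by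
        unfold sa; rw [if_neg h0]
      rw [e0]
      by_cases h1 : N + 1 < a
      · rw [if_pos h1, if_pos (by omega)]; omega
      · rw [if_neg h1]
        by_cases h2 : N < a
        · rw [if_pos h2]; omega
        · rw [if_neg h2]; omega
lemma good_se : Good se := by
  constructor <;> intro N <;> unfold se <;> omega
lemma good_so : Good so := by
  constructor <;> intro N <;> unfold so <;> omega

lemma tendsto_dl {f : ℕ → ℕ → ℕ} {s : ℕ → ℕ} (h : ∀ N, ∀ a, N < a → f a N = s N) :
    Tendsto (fun a => dl (f a)) atTop (nhds (dl s)) := by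
  rw [tendsto_pi_nhds]; intro N
  rw [tendsto_pi_nhds]; intro b
  apply tendsto_const_nhds.congr'
  filter_upwards [eventually_gt_atTop N] with a ha
  simp [dl, h N a ha]

lemma ext_sub {ν : ℕ → ℕ → ℝ} (h : ν ∈ Set.extremePoints ℝ (Dpi pi8)) :
    (∃ a, ν = dl (sa a)) ∨ ν = dl se ∨ ν = dl so := by
  by_contra hcon
  push Not at hcon
  obtain ⟨hA, hE, hO⟩ := hcon
  have hm : ν ∈ Dpi pi8 := h.1
  have h4 := hm.2
  simp only [pi8_eq] at h4
  have hz : ∀ a, ν (a + 2) a = 0 := by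
    intro a
    by_contra hne
    have hpos : 0 < ν (a + 2) a := lt_of_le_of_ne (hm.1.1 _ _) (Ne.symm hne)
    apply hA a
    refine eq_dl (good_sa a) h hpos fun N => ?_
    have hc : ∀ k, ν (a + 2 + k) a = ν (a + 2) a := by
      intro k
      induction k with
      | zero => rfl
      | succ k ih =>
        have := h4 (a + 2 + k) a (by omega)
        rw [if_neg (by omega)] at this
        rw [← ih, this, ← add_assoc]; ring
    have := path_antitone (good_sa a) hm (show N ≤ a + 2 + N by omega)
    simp only at this
    have e : sa a (a + 2 + N) = a := by unfold sa; split_ifs <;> omega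
    rw [e, hc] at this
    exact this
  have hstep : ∀ N, 1 ≤ N → ν (N + 2) (N + 2) = ν N N := by
    intro N hN
    have e1 := h4 N N le_rfl
    rw [if_neg (by omega)] at e1
    have e2 := h4 (N + 1) N (by omega)
    rw [if_pos (by omega), add_assoc] at e2
    have := hz N
    norm_num at e1 e2
    linarith
  have h1 : ν 1 1 = ν 2 1 := by
    have e1 := h4 1 1 le_rfl
    norm_num at e1
    exact e1
  have hsum : ν 2 1 + ν 2 2 = 1 := by
    have := hm.1.2.2.1 2
    simp only [Finset.sum_range_succ, Finset.sum_range_zero] at this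
    have := hz 0
    norm_num at this
    linarith
  have ho : ∀ k, ν (2 * k + 1) (2 * k + 1) = ν 1 1 := by
    intro k
    induction k with
    | zero => rfl
    | succ k ih => rw [← ih]; exact hstep (2 * k + 1) (by omega)
  have he : ∀ k, ν (2 * k + 2) (2 * k + 2) = ν 2 2 := by
    intro k
    induction k with
    | zero => rfl
    | succ k ih => rw [← ih]; exact hstep (2 * k + 2) (by omega)
  by_cases hp : 0 < ν 1 1
  · apply hO
    refine eq_dl good_so h hp fun N => ?_
    have := path_antitone good_so hm (show N ≤ 2 * N + 1 by omega)
    simp only at this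
    rw [show so (2 * N + 1) = 2 * N + 1 by unfold so; omega, ho] at this
    exact this
  · apply hE
    refine eq_dl good_se h (t := ν 2 2) (by linarith) fun N => ?_
    have := path_antitone good_se hm (show N ≤ 2 * N + 2 by omega)
    simp only at this
    rw [show se (2 * N + 2) = 2 * N + 2 by unfold se; omega, he] at this
    exact this

/-- for the balayage `π_0 = δ_0`, `π_N = δ_{N-1}` (N ≥ 1), one has
`ν^{2a} → ν^even` and `ν^{2a+1} → ν^odd`, and the set of extreme points of `𝒟(π)` is exactly
`{ν^a : a ∈ ℕ} ∪ {ν^even, ν^odd}`. -/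
theorem statement8 :
    Tendsto (fun a => nu8 (2 * a)) atTop (nhds nu8even) ∧
    Tendsto (fun a => nu8 (2 * a + 1)) atTop (nhds nu8odd) ∧
    Set.extremePoints ℝ (Dpi pi8) = Set.range nu8 ∪ {nu8even, nu8odd} := by
  simp only [nu8even_eq, nu8odd_eq, nu8_eq]
  refine ⟨tendsto_dl fun N a h => ?_, tendsto_dl fun N a h => ?_, ?_⟩
  · unfold sa se; split_ifs <;> omega
  · unfold sa so; split_ifs <;> omega
  · ext ν
    simp only [Set.mem_union, Set.mem_range, Set.mem_insert_iff, Set.mem_singleton_iff, nu8_eq]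
    constructor
    · intro h
      rcases ext_sub h with ⟨a, h⟩ | h
      · exact Or.inl ⟨a, h.symm⟩
      · exact Or.inr h
    · rintro (⟨a, rfl⟩ | rfl | rfl)
      · exact dl_extreme (good_sa a)
      · exact dl_extreme good_se
      · exact dl_extreme good_so

end VMCPaper
end

section
/- Let π be the balayage with π_0 = δ_0 and π_N the uniform distribution on {1,…,N} for N ≥ 1. For a ∈ ℕ let ν^a := {ν^a_N}_{N∈ℕ} with ν^a_0 = δ_0, ν^a_N = Uniform{1,…,N} for 0 < N < a, and ν^a_N = δ_a for N ≥ a; let U := {U_N}_{N∈ℕ} with U_0 = δ_0 and U_N = Uniform{1,…,N} for N ≥ 1. Then ν^a → U in 𝒟 as a → ∞, the set ext(𝒟(π)) is compact, and ext(𝒟(π)) = {ν^a : a ∈ ℕ} ∪ {U}; in particular, U is an extreme point of 𝒟(π). -/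
open MeasureTheory Filter
open scoped ENNReal NNReal

namespace VMCPaper

/-- the balayage with `π_0 = δ_0` and `π_N = Uniform{1,…,N}` for `N ≥ 1` -/
noncomputable def pi9 : ℕ → ℕ → ℝ := fun N b =>
  if N = 0 then (if b = 0 then 1 else 0)
  else (if 1 ≤ b ∧ b ≤ N then (1 : ℝ) / N else 0)

/-- the virtual uniform distribution: `U_0 = δ_0` and `U_N = Uniform{1,…,N}` for `N ≥ 1` -/
noncomputable def uni : ℕ → ℕ → ℝ := pi9

/-- `ν^a` with `ν^a_0 = δ_0`, `ν^a_N = Uniform{1,…,N}` for `0 < N < a`, `ν^a_N = δ_a`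
for `N ≥ a` -/
noncomputable def nu9 (a : ℕ) : ℕ → ℕ → ℝ := fun N b =>
  if N = 0 then (if b = 0 then 1 else 0)
  else if N < a then uni N b
  else (if b = a then 1 else 0)

lemma pi9_nonneg (N b : ℕ) : 0 ≤ pi9 N b := by
  unfold pi9; split_ifs <;> positivity

lemma pi9_supp (N b : ℕ) (h : N < b) : pi9 N b = 0 := by
  unfold pi9; split_ifs <;> first | rfl | omega

lemma pi9_sum (N : ℕ) : ∑ a ∈ Finset.range (N + 1), pi9 N a = 1 := by
  rcases N with _ | n
  · simp [pi9]
  · rw [Finset.sum_range_succ']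
    have h : ∀ i ∈ Finset.range (n + 1), pi9 (n + 1) (i + 1) = 1 / ((n + 1 : ℕ) : ℝ) := by
      intro i hi
      rw [Finset.mem_range] at hi
      have h2 : 1 ≤ i + 1 ∧ i + 1 ≤ n + 1 := by omega
      simp only [pi9, if_pos h2]
      simp
    rw [Finset.sum_congr rfl h]
    have h0 : pi9 (n + 1) 0 = 0 := by simp [pi9]
    rw [h0, Finset.sum_const, Finset.card_range, nsmul_eq_mul, add_zero]
    have : ((n + 1 : ℕ) : ℝ) ≠ 0 := by positivity
    field_simp

def Rec (ν : ℕ → ℕ → ℝ) : Prop :=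
  ∀ N a, a ≤ N → ν N a = ν (N + 1) a + ν (N + 1) (N + 1) * pi9 N a

lemma mem_Dpi_of {ν : ℕ → ℕ → ℝ} (h0 : ∀ N a, 0 ≤ ν N a) (h1 : ∀ N a, N < a → ν N a = 0)
    (h2 : ∀ N, ∑ a ∈ Finset.range (N + 1), ν N a = 1) (h3 : Rec ν) : ν ∈ Dpi pi9 := by
  refine ⟨⟨h0, h1, h2, ?_⟩, h3⟩
  intro N a ha
  rw [h3 N a ha]
  have := mul_nonneg (h0 (N + 1) (N + 1)) (pi9_nonneg N a)
  linarith

lemma uni_rec : Rec uni := by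
  intro N a ha
  rcases N with _ | n
  · have : a = 0 := by omega
    subst this
    simp [uni, pi9]
  · rcases a with _ | a
    · simp [uni, pi9]
    · have h1 : a ≤ n := by omega
      have h2 : a ≤ n + 1 := by omega
      have h3 : ((n : ℝ) + 1) ≠ 0 := by positivity
      have h4 : ((n : ℝ) + 1 + 1) ≠ 0 := by positivity
      simp [uni, pi9, h1, h2]
      field_simp

lemma uni_mem : uni ∈ Dpi pi9 := mem_Dpi_of pi9_nonneg pi9_supp pi9_sum uni_rec

lemma nu9_lt {a N : ℕ} (h : N < a) : nu9 a N = uni N := by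
  funext b
  by_cases hN : N = 0
  · simp [nu9, uni, pi9, hN]
  · simp [nu9, hN, h]

lemma nu9_zero (a : ℕ) : nu9 a 0 = uni 0 := by
  funext b
  simp [nu9, uni, pi9]

lemma nu9_ge {a N : ℕ} (h0 : 1 ≤ N) (h : a ≤ N) (b : ℕ) :
    nu9 a N b = if b = a then 1 else 0 := by
  have h1 : N ≠ 0 := by omega
  have h2 : ¬ N < a := by omega
  simp [nu9, h1, h2]

lemma nu9_mem (a : ℕ) : nu9 a ∈ Dpi pi9 := by
  have key : ∀ N, nu9 a N = uni N ∨ (1 ≤ N ∧ a ≤ N) := by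
    intro N
    by_cases h : N < a
    · exact Or.inl (nu9_lt h)
    · by_cases h0 : N = 0
      · subst h0; exact Or.inl (nu9_zero a)
      · right; omega
  apply mem_Dpi_of
  · intro N b
    rcases key N with h | ⟨h, h'⟩
    · rw [h]; exact pi9_nonneg N b
    · rw [nu9_ge h h']; split_ifs <;> norm_num
  · intro N b hb
    rcases key N with h | ⟨h, h'⟩
    · rw [h]; exact pi9_supp N b hb
    · rw [nu9_ge h h', if_neg (by omega)]
  · intro N
    rcases key N with h | ⟨h, h'⟩
    · rw [h]; exact pi9_sum N
    · rw [Finset.sum_congr rfl (fun b _ => nu9_ge h h' b), Finset.sum_ite_eq',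
        if_pos (Finset.mem_range.2 (by omega))]
  · intro N b hb
    by_cases h : N + 1 < a
    · rw [nu9_lt h, nu9_lt (by omega : N < a)]; exact uni_rec N b hb
    · have hge := fun b => nu9_ge (a := a) (N := N + 1) (by omega) (by omega) b
      rw [hge, hge]
      by_cases h1 : N + 1 = a
      · rw [nu9_lt (by omega : N < a), if_neg (by omega), if_pos h1]
        simp [uni]
      · rw [if_neg h1]
        by_cases h0 : N = 0
        · have hb0 : b = 0 := by omega
          have ha0 : a = 0 := by omega
          subst h0 hb0 ha0
          simp [nu9]
        · rw [nu9_ge (by omega) (by omega)]; simp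

lemma eq_down {ν μ : ℕ → ℕ → ℝ} (hν : ν ∈ Dpi pi9) (hμ : μ ∈ Dpi pi9) (k : ℕ) :
    ∀ N, ν (N + k) = μ (N + k) → ν N = μ N := by
  induction k with
  | zero => intro N h; exact h
  | succ k ih =>
    intro N h
    apply ih
    funext b
    by_cases hb : b ≤ N + k
    · rw [hν.2 _ b hb, hμ.2 _ b hb]
      have h' : ν (N + k + 1) = μ (N + k + 1) := h
      rw [h']
    · rw [hν.1.2.1 _ b (by omega), hμ.1.2.1 _ b (by omega)]

lemma eq_of_eventually {ν μ : ℕ → ℕ → ℝ} (hν : ν ∈ Dpi pi9) (hμ : μ ∈ Dpi pi9) (m : ℕ)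
    (h : ∀ N, m ≤ N → ν N = μ N) : ν = μ := by
  funext N
  exact eq_down hν hμ m N (h _ (by omega))

lemma nonneg_down {g : ℕ → ℕ → ℝ} (hg : Rec g) (hs : ∀ N a, N < a → g N a = 0) (k : ℕ) :
    ∀ N, (∀ b, 0 ≤ g (N + k) b) → ∀ b, 0 ≤ g N b := by
  induction k with
  | zero => intro N h; exact h
  | succ k ih =>
    intro N h
    apply ih
    intro b
    by_cases hb : b ≤ N + k
    · rw [hg _ b hb]
      have h1 := h b
      have h2 := mul_nonneg (h (N + k + 1)) (pi9_nonneg (N + k) b)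
      have h1' : 0 ≤ g (N + k + 1) b := h1
      exact add_nonneg h1' h2
    · rw [hs _ b (by omega)]

lemma anti {ν : ℕ → ℕ → ℝ} (hν : ν ∈ Dpi pi9) {a N : ℕ} (ha : a ≤ N) :
    ∀ M, N ≤ M → ν M a ≤ ν N a := by
  intro M hM
  induction M, hM using Nat.le_induction with
  | base => exact le_rfl
  | succ M hM ih => exact (hν.1.2.2.2 M a (by omega)).trans ih

lemma diff_const {ν : ℕ → ℕ → ℝ} (hν : ν ∈ Dpi pi9) {a b N : ℕ} (ha : a ≤ N) (ha1 : 1 ≤ a)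
    (hb : b ≤ N) (hb1 : 1 ≤ b) : ∀ M, N ≤ M → ν N a - ν N b = ν M a - ν M b := by
  intro M hM
  induction M, hM using Nat.le_induction with
  | base => rfl
  | succ M hM ih =>
    rw [ih, hν.2 M a (by omega), hν.2 M b (by omega)]
    have h : pi9 M a = pi9 M b := by
      have h1 : 1 ≤ a ∧ a ≤ M := by omega
      have h2 : 1 ≤ b ∧ b ≤ M := by omega
      have h3 : M ≠ 0 := by omega
      simp [pi9, h1, h2, h3]
    rw [h]; ring

lemma zero_const {ν : ℕ → ℕ → ℝ} (hν : ν ∈ Dpi pi9) {N : ℕ} (h : 1 ≤ N) :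
    ∀ M, N ≤ M → ν M 0 = ν N 0 := by
  intro M hM
  induction M, hM using Nat.le_induction with
  | base => rfl
  | succ M hM ih =>
    rw [← ih, hν.2 M 0 (by omega)]
    have h3 : M ≠ 0 := by omega
    simp [pi9, h3]

def Small (ν : ℕ → ℕ → ℝ) : Prop :=
  ∀ a, ∀ c : ℝ, 0 < c → c < 1 → ∃ N, a ≤ N ∧ ν N a < c

lemma small_ev {ν : ℕ → ℕ → ℝ} (hν : ν ∈ Dpi pi9) (hs : Small ν) (a : ℕ) (c : ℝ) (hc : 0 < c) :
    ∃ N, a ≤ N ∧ ∀ M, N ≤ M → ν M a < c := by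
  obtain ⟨N, hN, h⟩ := hs a (min c (1/2)) (by positivity)
    ((min_le_right _ _).trans_lt (by norm_num))
  exact ⟨N, hN, fun M hM => (anti hν hN M hM).trans_lt (h.trans_le (min_le_left _ _))⟩

lemma eq_uni_of_small {ν : ℕ → ℕ → ℝ} (hν : ν ∈ Dpi pi9) (hs : Small ν) : ν = uni := by
  apply eq_of_eventually hν uni_mem 1
  intro N hN
  have h0 : ν N 0 = 0 := by
    apply le_antisymm _ (hν.1.1 N 0)
    apply le_of_forall_pos_le_add
    intro c hc
    obtain ⟨K, -, hK⟩ := small_ev hν hs 0 c hc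
    have := hK (max K N) (le_max_left _ _)
    rw [zero_const hν hN _ (le_max_right _ _)] at this
    linarith
  have hle : ∀ a b, 1 ≤ a → a ≤ N → 1 ≤ b → b ≤ N → ν N a ≤ ν N b := by
    intro a b ha1 ha hb1 hb
    apply le_of_forall_pos_le_add
    intro c hc
    obtain ⟨K, -, hK⟩ := small_ev hν hs a c hc
    have h1 := hK (max K N) (le_max_left _ _)
    have h2 := diff_const hν ha ha1 hb hb1 _ (le_max_right K N)
    have h3 := hν.1.1 (max K N) b
    linarith
  have hsum := hν.1.2.2.1 N
  have hN0 : (N : ℝ) ≠ 0 := by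
    have : N ≠ 0 := by omega
    exact_mod_cast this
  have hN' : N ≠ 0 := by omega
  funext b
  by_cases hb : 1 ≤ b ∧ b ≤ N
  · rw [Finset.sum_range_succ', h0, add_zero,
      Finset.sum_congr rfl (fun i hi => le_antisymm
        (hle (i + 1) b (by omega) (by have := Finset.mem_range.1 hi; omega) hb.1 hb.2)
        (hle b (i + 1) hb.1 hb.2 (by omega) (by have := Finset.mem_range.1 hi; omega))),
      Finset.sum_const, Finset.card_range, nsmul_eq_mul] at hsum
    simp only [uni, pi9, if_neg hN', if_pos hb]
    field_simp
    linarith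
  · simp only [uni, pi9, if_neg hN', if_neg hb]
    by_cases hb0 : b = 0
    · rw [hb0, h0]
    · exact hν.1.2.1 N b (by omega)

lemma uni_small : Small uni := by
  intro a c hc _
  obtain ⟨n, hn⟩ := exists_nat_one_div_lt hc
  refine ⟨a + n + 1, by omega, ?_⟩
  have hb : uni (a + n + 1) a ≤ 1 / ((n : ℝ) + 1) := by
    simp only [uni, pi9]
    rw [if_neg (by omega)]
    split_ifs
    · apply one_div_le_one_div_of_le (by positivity)
      push_cast
      have : (0 : ℝ) ≤ a := by positivity
      linarith
    · positivity
  linarith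

lemma uni_ext : uni ∈ Set.extremePoints ℝ (Dpi pi9) := by
  refine ⟨uni_mem, ?_⟩
  rintro x hx y hy ⟨s, t, hs, ht, hst, h⟩
  apply eq_uni_of_small hx
  intro a c hc hc1
  obtain ⟨N, hN, hlt⟩ := small_ev uni_mem uni_small a (s * c) (by positivity)
  refine ⟨N, hN, ?_⟩
  have h1 := hlt N le_rfl
  rw [← h] at h1
  simp only [Pi.add_apply, Pi.smul_apply, smul_eq_mul] at h1
  have h2 := mul_nonneg ht.le (hy.1.1 N a)
  exact lt_of_mul_lt_mul_left (by linarith) hs.le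

lemma eq_nu9_of {x : ℕ → ℕ → ℝ} (hx : x ∈ Dpi pi9) (a : ℕ)
    (h : ∀ N, 1 ≤ N → a ≤ N → ∀ b, b ≠ a → x N b = 0) : x = nu9 a := by
  apply eq_of_eventually hx (nu9_mem a) (a + 1)
  intro N hN
  have hz := h N (by omega) (by omega)
  funext b
  rw [nu9_ge (by omega) (by omega)]
  split_ifs with hb
  · subst hb
    have hs := hx.1.2.2.1 N
    rwa [Finset.sum_eq_single b (fun i _ hi => hz i hi)
      (fun hn => absurd (Finset.mem_range.2 (by omega)) hn)] at hs
  · exact hz b hb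

lemma nu9_ext (a : ℕ) : nu9 a ∈ Set.extremePoints ℝ (Dpi pi9) := by
  refine ⟨nu9_mem a, ?_⟩
  rintro x hx y hy ⟨s, t, hs, ht, hst, h⟩
  apply eq_nu9_of hx
  intro N hN ha b hb
  have h1 := nu9_ge hN ha b
  rw [if_neg hb, ← h] at h1
  simp only [Pi.add_apply, Pi.smul_apply, smul_eq_mul] at h1
  have h2 := mul_nonneg ht.le (hy.1.1 N b)
  have h3 := mul_nonneg hs.le (hx.1.1 N b)
  have h4 : s * x N b = 0 := by linarith
  exact (mul_eq_zero.1 h4).resolve_left hs.ne'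

lemma ext_sub_s9 {ν : ℕ → ℕ → ℝ} (h : ν ∈ Set.extremePoints ℝ (Dpi pi9)) :
    ν = uni ∨ ∃ a, nu9 a = ν := by
  obtain ⟨hν, hext⟩ := h
  by_cases hs : Small ν
  · exact Or.inl (eq_uni_of_small hν hs)
  right
  unfold Small at hs
  push Not at hs
  obtain ⟨a, c, hc, hc1, hge⟩ := hs
  refine ⟨a, ?_⟩
  have ha := nu9_mem a
  have hd : 0 < 1 - c := by linarith
  let g : ℕ → ℕ → ℝ := fun N b => ν N b - c * nu9 a N b
  have hgs : ∀ N b, N < b → g N b = 0 := by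
    intro N b hb
    simp only [g, hν.1.2.1 N b hb, ha.1.2.1 N b hb]; ring
  have hgr : Rec g := by
    intro N b hb
    simp only [g, hν.2 N b hb, ha.2 N b hb]; ring
  have hg0 : ∀ N b, 0 ≤ g N b := by
    intro N
    apply nonneg_down hgr hgs (a + 1)
    intro b
    simp only [g]
    rw [nu9_ge (by omega) (by omega)]
    split_ifs with hb
    · subst hb
      have := hge (N + (b + 1)) (by omega)
      linarith
    · have := hν.1.1 (N + (a + 1)) b
      linarith
  have hρ : (fun N b => (1 - c)⁻¹ * g N b) ∈ Dpi pi9 := by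
    apply mem_Dpi_of
    · intro N b
      exact mul_nonneg (inv_nonneg.2 hd.le) (hg0 N b)
    · intro N b hb
      simp only [hgs N b hb, mul_zero]
    · intro N
      rw [← Finset.mul_sum]
      simp only [g]
      rw [Finset.sum_sub_distrib, ← Finset.mul_sum, hν.1.2.2.1, ha.1.2.2.1, mul_one]
      exact inv_mul_cancel₀ hd.ne'
    · intro N b hb
      simp only
      rw [hgr N b hb]; ring
  apply hext ha hρ
  refine ⟨c, 1 - c, hc, hd, by ring, ?_⟩
  funext N b
  simp only [Pi.add_apply, Pi.smul_apply, smul_eq_mul, g]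
  rw [mul_inv_cancel_left₀ hd.ne']
  ring

lemma nu9_tendsto : Tendsto nu9 atTop (nhds uni) := by
  rw [tendsto_pi_nhds]
  intro N
  apply tendsto_const_nhds.congr'
  filter_upwards [eventually_gt_atTop N] with a ha
  exact (nu9_lt ha).symm

/-- for the balayage `π_0 = δ_0`, `π_N = Uniform{1,…,N}` (N ≥ 1), one has
`ν^a → U`, the set of extreme points of `𝒟(π)` is compact and equal to
`{ν^a : a ∈ ℕ} ∪ {U}`; in particular `U` is an extreme point of `𝒟(π)`. -/
theorem statement9 :
    Tendsto nu9 atTop (nhds uni) ∧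
    IsCompact (Set.extremePoints ℝ (Dpi pi9)) ∧
    Set.extremePoints ℝ (Dpi pi9) = Set.range nu9 ∪ {uni} ∧
    uni ∈ Set.extremePoints ℝ (Dpi pi9) := by
  have heq : Set.extremePoints ℝ (Dpi pi9) = Set.range nu9 ∪ {uni} := by
    ext ν
    constructor
    · intro h
      rcases ext_sub_s9 h with h | h
      · exact Or.inr h
      · exact Or.inl h
    · rintro (⟨a, rfl⟩ | h)
      · exact nu9_ext a
      · rw [Set.mem_singleton_iff] at h
        rw [h]; exact uni_ext
  refine ⟨nu9_tendsto, ?_, heq, uni_ext⟩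
  rw [heq, Set.union_singleton]
  exact nu9_tendsto.isCompact_insert_range

end VMCPaper
end
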